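/- Fix d ≥ 1, L > 0, a compact convex full-dimensional set Ω ⊂ ℝ^d, and t ∈ [0,1]. Suppose c > 0 and the sequence of block sizes satisfies k_m ≤ c·m^t for all m large enough. Then (m,k_m)-spectrahedral functions cannot uniformly approximate the class C_L(Ω) at any rate faster than m^{−2(1+t)/d}: for every constant c1 > 0 and every r > (4/d)(1+t), there exist an integer m ≥ 1 and a function f_* ∈ C_L(Ω) such that inf_{f ∈ F_{m,k_m}} sup_{x ∈ Ω} |f(x) − f_*(x)|² > c1 · m^{−r}. Consequently, for all ε > 0 and all m large enough, sup_{f_* ∈ C_L(Ω)} inf_{f ∈ F_{m,k_m}} ‖f − f_*‖_∞ ≥ c_{d,L,Ω} · m^{−2(1+t)/d − ε} for a constant c_{d,L,Ω} > 0. -/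

import Mathlib

open MeasureTheory ProbabilityTheory
open scoped BigOperators NNReal

noncomputable section

/-- The quadratic form `v ↦ vᵀ A v`. -/
def rayleigh {m : ℕ} (A : Matrix (Fin m) (Fin m) ℝ) (v : Fin m → ℝ) : ℝ :=
  ∑ i, ∑ j, v i * A i j * v j

/-- The largest eigenvalue of a symmetric matrix, as the supremum of the Rayleigh
quotient over the unit sphere. -/
def lambdaMax {m : ℕ} (A : Matrix (Fin m) (Fin m) ℝ) : ℝ :=
  sSup {r : ℝ | ∃ v : Fin m → ℝ, (∑ i, v i ^ 2) = 1 ∧ r = rayleigh A v}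

/-- `𝕊^m_k` : m×m real symmetric matrices, block diagonal with blocks of size at most k. -/
def SBlock (m : ℕ) (k : ℝ) : Set (Matrix (Fin m) (Fin m) ℝ) :=
  {A | A.IsSymm ∧ ∀ i j : Fin m, ⌊(i : ℝ) / k⌋ ≠ ⌊(j : ℝ) / k⌋ → A i j = 0}

/-- The linear pencil `𝒜[x] = ∑ i, x i • A i`. -/
def pencil {m d : ℕ} (A : Fin d → Matrix (Fin m) (Fin m) ℝ) (x : Fin d → ℝ) :
    Matrix (Fin m) (Fin m) ℝ := ∑ i, x i • A i

/-- The class `F_{m,k}` of `(m,k)`-spectrahedral functions on `ℝ^d`. -/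
def SpecFuns (m : ℕ) (k : ℝ) (d : ℕ) : Set ((Fin d → ℝ) → ℝ) :=
  {f | ∃ (A : Fin d → Matrix (Fin m) (Fin m) ℝ) (B : Matrix (Fin m) (Fin m) ℝ),
    (∀ i, A i ∈ SBlock m k) ∧ B ∈ SBlock m k ∧ ∀ x, f x = lambdaMax (pencil A x + B)}

section Families

open scoped RealInnerProductSpace

variable {H : Type*} [NormedAddCommGroup H] [InnerProductSpace ℝ H]
variable {ι : Type*} [Fintype ι]

/-- The synthesis operator `c ↦ ∑ c w • u w` has squared norm at most `κ`. -/
def SynthesisBound (κ : ℝ) (u : ι → H) : Prop :=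
  ∀ c : ι → ℝ, ‖∑ w, c w • u w‖ ^ 2 ≤ κ * ∑ w, c w ^ 2

lemma SynthesisBound.bessel {κ : ℝ} (hκ : 0 ≤ κ) {u : ι → H} (hu : SynthesisBound κ u) (h : H) :
    ∑ w, ⟪u w, h⟫ ^ 2 ≤ κ * ‖h‖ ^ 2 := by
  set S := ∑ w, ⟪u w, h⟫ ^ 2 with hS
  have h1 := hu (fun w => ⟪u w, h⟫)
  have h2 : S = ⟪∑ w, ⟪u w, h⟫ • u w, h⟫ := by
    rw [sum_inner, hS]
    refine Finset.sum_congr rfl fun w _ => ?_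
    rw [real_inner_smul_left, sq]
  have h3 : S ^ 2 ≤ ‖∑ w, ⟪u w, h⟫ • u w‖ ^ 2 * ‖h‖ ^ 2 := by
    rw [h2, ← mul_pow]
    exact sq_le_sq' (by linarith [neg_abs_le ⟪∑ w, ⟪u w, h⟫ • u w, h⟫,
      abs_real_inner_le_norm (∑ w, ⟪u w, h⟫ • u w) h]) (real_inner_le_norm _ _)
  have hS0 : 0 ≤ S := Finset.sum_nonneg fun _ _ => sq_nonneg _
  have h4 : S ^ 2 ≤ κ * S * ‖h‖ ^ 2 :=
    h3.trans (mul_le_mul_of_nonneg_right h1 (sq_nonneg _))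
  rcases hS0.eq_or_lt with h0 | h0
  · rw [← h0]; positivity
  · nlinarith

lemma SynthesisBound.norm_sq_le {κ : ℝ} {u : ι → H} (hu : SynthesisBound κ u) (w : ι) :
    ‖u w‖ ^ 2 ≤ κ := by
  classical
  have := hu (fun w' => if w' = w then 1 else 0)
  simpa using this

lemma SynthesisBound.smul {κ a : ℝ} (ha : 0 < a) {z : ι → H}
    (hz : ∀ c : ι → ℝ, ‖∑ w, c w • z w‖ ^ 2 ≤ a ^ 2 * (κ * ∑ w, c w ^ 2)) :
    SynthesisBound κ (fun w => a⁻¹ • z w) := by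
  intro c
  have h1 : ∑ w, c w • a⁻¹ • z w = a⁻¹ • ∑ w, c w • z w := by
    rw [Finset.smul_sum]
    exact Finset.sum_congr rfl fun w _ => smul_comm _ _ _
  rw [h1, norm_smul, mul_pow, Real.norm_eq_abs, sq_abs]
  have h2 := hz c
  calc a⁻¹ ^ 2 * ‖∑ w, c w • z w‖ ^ 2
      ≤ a⁻¹ ^ 2 * (a ^ 2 * (κ * ∑ w, c w ^ 2)) := by gcongr
    _ = κ * ∑ w, c w ^ 2 := by field_simp

lemma isCompact_synthesisBound [FiniteDimensional ℝ H] (κ : ℝ) :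
    IsCompact {u : ι → H | SynthesisBound κ u} := by
  have : ProperSpace H := FiniteDimensional.proper ℝ H
  refine Metric.isCompact_of_isClosed_isBounded ?_ ?_
  · have : {u : ι → H | SynthesisBound κ u} =
        ⋂ c : ι → ℝ, {u : ι → H | ‖∑ w, c w • u w‖ ^ 2 ≤ κ * ∑ w, c w ^ 2} := by
      ext u; simp [SynthesisBound]
    rw [this]
    exact isClosed_iInter fun c => isClosed_le (by fun_prop) (by fun_prop)
  · refine (Metric.isBounded_closedBall (x := (0 : ι → H)) (r := Real.sqrt κ)).subset ?_
    intro u hu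
    rw [mem_closedBall_zero_iff, pi_norm_le_iff_of_nonneg (Real.sqrt_nonneg _)]
    intro w
    exact Real.le_sqrt_of_sq_le (SynthesisBound.norm_sq_le hu w)

/-- Norm bound for `(1 - ε X²) p + √(2ε) X q`. -/
lemma norm_sq_heat_le {X : H →L[ℝ] H} (hX : ∀ x y, ⟪X x, y⟫ = ⟪x, X y⟫) {ε Λ s : ℝ}
    (hΛ : ∀ h, ‖X (X h)‖ ^ 2 ≤ Λ * ‖h‖ ^ 2) (hs : s ^ 2 = 2 * ε) (p q : H) :
    ‖p - ε • X (X p) + s • X q‖ ^ 2 ≤ (1 + ε ^ 2 * Λ) * (‖p‖ ^ 2 + ‖q‖ ^ 2) := by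
  set h := p - ε • X (X p) + s • X q with hh
  set a := h - ε • X (X h) with ha
  set b := s • X h with hb
  have h1 : ‖h‖ ^ 2 = ⟪p, a⟫ + ⟪q, b⟫ := by
    rw [← real_inner_self_eq_norm_sq]
    nth_rewrite 1 [hh]
    rw [inner_add_left, inner_sub_left, real_inner_smul_left, real_inner_smul_left, hX, hX, hX,
      ha, hb, inner_sub_right, real_inner_smul_right, real_inner_smul_right]
  have h2 : ‖a‖ ^ 2 + ‖b‖ ^ 2 = ‖h‖ ^ 2 + ε ^ 2 * ‖X (X h)‖ ^ 2 := by
    rw [ha, hb, norm_sub_sq_real, norm_smul, norm_smul, real_inner_smul_right, ← hX,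
      real_inner_self_eq_norm_sq, mul_pow, mul_pow, Real.norm_eq_abs, Real.norm_eq_abs, sq_abs,
      sq_abs, hs]
    ring
  have h3 := hΛ h
  have h4 : ‖h‖ ^ 2 ≤ ‖p‖ * ‖a‖ + ‖q‖ * ‖b‖ := by
    rw [h1]; exact add_le_add (real_inner_le_norm _ _) (real_inner_le_norm _ _)
  have h5 : (‖h‖ ^ 2) ^ 2 ≤ (‖p‖ ^ 2 + ‖q‖ ^ 2) * (‖a‖ ^ 2 + ‖b‖ ^ 2) := by
    calc (‖h‖ ^ 2) ^ 2 ≤ (‖p‖ * ‖a‖ + ‖q‖ * ‖b‖) ^ 2 := by gcongr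
      _ ≤ _ := by nlinarith [sq_nonneg (‖p‖ * ‖b‖ - ‖q‖ * ‖a‖)]
  have h6 : ‖a‖ ^ 2 + ‖b‖ ^ 2 ≤ (1 + ε ^ 2 * Λ) * ‖h‖ ^ 2 := by
    rw [h2]; nlinarith [sq_nonneg ε]
  have h7 : (‖h‖ ^ 2) ^ 2 ≤ (‖p‖ ^ 2 + ‖q‖ ^ 2) * ((1 + ε ^ 2 * Λ) * ‖h‖ ^ 2) :=
    h5.trans (by gcongr)
  rcases (sq_nonneg ‖h‖).eq_or_lt with h0 | h0
  · rw [← h0]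
    by_cases hp : ‖p‖ ^ 2 + ‖q‖ ^ 2 = 0
    · rw [hp]; simp
    · have hpos : 0 < ‖p‖ ^ 2 + ‖q‖ ^ 2 := lt_of_le_of_ne (by positivity) (Ne.symm hp)
      have : ∃ y : H, 0 < ‖y‖ ^ 2 := by
        by_contra! hcon
        nlinarith [hcon p, hcon q]
      obtain ⟨y, hy⟩ := this
      have hΛ0 : 0 ≤ Λ := by
        have := (sq_nonneg _).trans (hΛ y)
        by_contra! hneg
        nlinarith
      positivity
  · nlinarith

/-- A first order condition from a one-sided polynomial inequality. -/
lemma nonpos_of_forall_quartic {a b c e : ℝ}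
    (h : ∀ ε : ℝ, 0 < ε → ε ≤ 1 → 0 ≤ -2 * ε * a + ε ^ 2 * b - 2 * ε ^ 3 * c + ε ^ 4 * e) :
    a ≤ 0 := by
  by_contra! ha
  set M := |b| + 2 * |c| + |e| + 1 with hM
  have hM0 : 0 < M := by positivity
  set ε := min 1 (a / M) with hε
  have hε0 : 0 < ε := lt_min one_pos (div_pos ha hM0)
  have hε1 : ε ≤ 1 := min_le_left _ _
  have hεM : ε * M ≤ a := by
    have : ε ≤ a / M := min_le_right _ _
    rwa [le_div_iff₀ hM0] at this
  have h1 := h ε hε0 hε1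
  have h2 : 0 ≤ ε * (-2 * a + ε * b - 2 * ε ^ 2 * c + ε ^ 3 * e) := by linarith
  have h3 := nonneg_of_mul_nonneg_right h2 hε0
  have hb : ε * b ≤ ε * |b| := by gcongr; exact le_abs_self b
  have e2 : ε ^ 2 ≤ ε := by nlinarith
  have e3 : ε ^ 3 ≤ ε := by nlinarith
  have hc : -(ε ^ 2 * c) ≤ ε * |c| := by
    calc -(ε ^ 2 * c) = ε ^ 2 * (-c) := by ring
      _ ≤ ε ^ 2 * |c| := by gcongr; exact neg_le_abs c
      _ ≤ _ := by gcongr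
  have he : ε ^ 3 * e ≤ ε * |e| := by
    calc ε ^ 3 * e ≤ ε ^ 3 * |e| := by gcongr; exact le_abs_self e
      _ ≤ _ := by gcongr
  have : ε * M = ε * |b| + 2 * (ε * |c|) + ε * |e| + ε := by rw [hM]; ring
  nlinarith

/-- Families with bounded synthesis operator have a metric projection that contracts every
commutator-type quantity `X u w - D w • u w`. -/
theorem exists_contracting [FiniteDimensional ℝ H] {κ : ℝ} (hκ : 0 ≤ κ) (v u₀ : ι → H)
    (h₀ : SynthesisBound κ u₀) :
    ∃ u : ι → H, SynthesisBound κ u ∧ ∑ w, ‖u w - v w‖ ^ 2 ≤ ∑ w, ‖u₀ w - v w‖ ^ 2 ∧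
      ∀ X : H →L[ℝ] H, (∀ x y, ⟪X x, y⟫ = ⟪x, X y⟫) → ∀ D : ι → ℝ,
        ∑ w, ‖X (u w) - D w • u w‖ ^ 2 ≤ ∑ w, ‖X (v w) - D w • v w‖ ^ 2 := by
  obtain ⟨u, hu, hmin⟩ := (isCompact_synthesisBound (ι := ι) (H := H) κ).exists_isMinOn ⟨u₀, h₀⟩
    (f := fun u => ∑ w, ‖u w - v w‖ ^ 2) (by fun_prop)
  replace hu : SynthesisBound κ u := hu
  refine ⟨u, hu, hmin h₀, fun X hX D => ?_⟩
  set Λ : ℝ := (‖X‖ * ‖X‖) ^ 2 with hΛdef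
  have hΛ0 : 0 ≤ Λ := by positivity
  have hΛ : ∀ h, ‖X (X h)‖ ^ 2 ≤ Λ * ‖h‖ ^ 2 := by
    intro h
    rw [hΛdef, ← mul_pow]
    gcongr
    calc ‖X (X h)‖ ≤ ‖X‖ * ‖X h‖ := X.le_opNorm _
      _ ≤ ‖X‖ * (‖X‖ * ‖h‖) := by gcongr; exact X.le_opNorm _
      _ = _ := by ring
  set C : ℝ := ∑ w, D w ^ 4 with hC
  have hC0 : 0 ≤ C := Finset.sum_nonneg fun _ _ => by positivity
  set C' := Λ + C with hC'
  set g : ι → H := fun w => X (X (u w)) - (2 * D w) • X (u w) + (D w ^ 2) • u w with hg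
  set f : ι → H := fun w => (D w ^ 2) • X (X (u w)) - C' • v w with hf
  have key : ∀ ε : ℝ, 0 < ε → ε ≤ 1 →
      ∑ w, ‖u w - v w‖ ^ 2 ≤ ∑ w, ‖(u w - v w) - ε • g w + ε ^ 2 • f w‖ ^ 2 := by
    intro ε hε hε1
    set s := Real.sqrt (2 * ε) with hs
    have hs2 : s ^ 2 = 2 * ε := Real.sq_sqrt (by positivity)
    set z : ι → H := fun w => u w - ε • g w + ε ^ 2 • (D w ^ 2) • X (X (u w)) with hz
    set a : ℝ := 1 + C' * ε ^ 2 with ha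
    have ha1 : 1 ≤ a := by rw [ha]; nlinarith [mul_nonneg (add_nonneg hΛ0 hC0) (sq_nonneg ε)]
    have hzb : ∀ c : ι → ℝ, ‖∑ w, c w • z w‖ ^ 2 ≤ a ^ 2 * (κ * ∑ w, c w ^ 2) := by
      intro c
      set p := ∑ w, (c w * (1 - ε * D w ^ 2)) • u w with hp
      set q := ∑ w, (c w * (s * D w)) • u w with hq
      have hsum : ∑ w, c w • z w = p - ε • X (X p) + s • X q := by
        rw [hp, hq]
        simp only [map_sum, map_smul, Finset.smul_sum, ← Finset.sum_sub_distrib,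
          ← Finset.sum_add_distrib]
        refine Finset.sum_congr rfl fun w _ => ?_
        rw [hz, hg]
        have : s * (c w * (s * D w)) = c w * (2 * ε) * D w := by rw [← hs2]; ring
        rw [smul_smul s, this]
        module
      have hp2 := hu (fun w => c w * (1 - ε * D w ^ 2))
      have hq2 := hu (fun w => c w * (s * D w))
      have h1 := norm_sq_heat_le hX hΛ hs2 p q
      have h2 : ‖p‖ ^ 2 + ‖q‖ ^ 2 ≤ κ * ((1 + ε ^ 2 * C) * ∑ w, c w ^ 2) := by
        refine (add_le_add hp2 hq2).trans ?_
        rw [← mul_add, ← Finset.sum_add_distrib, Finset.mul_sum _ _ (1 + ε ^ 2 * C)]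
        refine mul_le_mul_of_nonneg_left (Finset.sum_le_sum fun w _ => ?_) hκ
        have h3 : (c w * (1 - ε * D w ^ 2)) ^ 2 + (c w * (s * D w)) ^ 2
            = (1 + ε ^ 2 * D w ^ 4) * c w ^ 2 := by
          have : (c w * (s * D w)) ^ 2 = s ^ 2 * (c w * D w) ^ 2 := by ring
          rw [this, hs2]; ring
        rw [h3]
        gcongr
        exact Finset.single_le_sum (f := fun w => D w ^ 4) (fun _ _ => by positivity)
          (Finset.mem_univ w)
      rw [hsum]
      have hc0 : 0 ≤ ∑ w, c w ^ 2 := Finset.sum_nonneg fun _ _ => sq_nonneg _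
      calc _ ≤ _ := h1
        _ ≤ (1 + ε ^ 2 * Λ) * (κ * ((1 + ε ^ 2 * C) * ∑ w, c w ^ 2)) := by gcongr
        _ = ((1 + ε ^ 2 * Λ) * (1 + ε ^ 2 * C)) * (κ * ∑ w, c w ^ 2) := by ring
        _ ≤ a ^ 2 * (κ * ∑ w, c w ^ 2) := by
          gcongr
          rw [ha, hC']
          have : 0 ≤ ε ^ 2 := sq_nonneg ε
          nlinarith [mul_nonneg this hΛ0, mul_nonneg this hC0,
            mul_nonneg (mul_nonneg this hΛ0) (mul_nonneg this hC0)]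
    have ha0 : 0 < a := by linarith
    have hfeas := SynthesisBound.smul (κ := κ) ha0 hzb
    have hm : ∑ w, ‖u w - v w‖ ^ 2 ≤ ∑ w, ‖a⁻¹ • z w - v w‖ ^ 2 := hmin hfeas
    have h4 : ∑ w, ‖(u w - v w) - ε • g w + ε ^ 2 • f w‖ ^ 2 =
        a ^ 2 * ∑ w, ‖a⁻¹ • z w - v w‖ ^ 2 := by
      rw [Finset.mul_sum]
      refine Finset.sum_congr rfl fun w _ => ?_
      have : (u w - v w) - ε • g w + ε ^ 2 • f w = a • (a⁻¹ • z w - v w) := by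
        rw [smul_sub a, smul_inv_smul₀ ha0.ne', hz, hf, ha]
        module
      rw [this, norm_smul, mul_pow, Real.norm_eq_abs, sq_abs]
    rw [h4]
    have h5 : 0 ≤ ∑ w, ‖a⁻¹ • z w - v w‖ ^ 2 := Finset.sum_nonneg fun _ _ => sq_nonneg _
    have h6 : 1 ≤ a ^ 2 := one_le_pow₀ ha1
    nlinarith
  have hsign : ∑ w, ⟪u w - v w, g w⟫ ≤ 0 := by
    refine nonpos_of_forall_quartic (b := ∑ w, (‖g w‖ ^ 2 + 2 * ⟪u w - v w, f w⟫))
      (c := ∑ w, ⟪g w, f w⟫) (e := ∑ w, ‖f w‖ ^ 2) fun ε hε hε1 => ?_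
    have h1 := key ε hε hε1
    rw [← sub_nonneg, ← Finset.sum_sub_distrib] at h1
    refine h1.trans_eq ?_
    simp only [Finset.mul_sum, ← Finset.sum_sub_distrib, ← Finset.sum_add_distrib]
    refine Finset.sum_congr rfl fun w _ => ?_
    rw [norm_add_sq_real, norm_sub_sq_real, inner_sub_left (u w - v w), norm_smul, norm_smul]
    simp only [real_inner_smul_left, real_inner_smul_right, mul_pow, Real.norm_eq_abs, sq_abs]
    ring
  have hexp : ∀ w, ⟪u w - v w, g w⟫ = ‖X (u w) - D w • u w‖ ^ 2
      - ⟪X (v w) - D w • v w, X (u w) - D w • u w⟫ := by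
    intro w
    rw [← real_inner_self_eq_norm_sq, ← inner_sub_left]
    have : X (u w) - D w • u w - (X (v w) - D w • v w)
        = X (u w - v w) - D w • (u w - v w) := by
      rw [map_sub]; module
    rw [this, inner_sub_left (X (u w - v w)), hX, real_inner_smul_left, hg]
    simp only [map_sub, map_smul, inner_sub_right, inner_add_right, real_inner_smul_right]
    ring
  have hfin : ∑ w, ‖X (u w) - D w • u w‖ ^ 2
      ≤ ∑ w, ⟪X (v w) - D w • v w, X (u w) - D w • u w⟫ := by
    rw [← sub_nonpos, ← Finset.sum_sub_distrib]
    simpa only [hexp] using hsign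
  have hyoung : ∑ w, ⟪X (v w) - D w • v w, X (u w) - D w • u w⟫
      ≤ ∑ w, (‖X (v w) - D w • v w‖ ^ 2 + ‖X (u w) - D w • u w‖ ^ 2) / 2 := by
    gcongr with w
    have := real_inner_le_norm (X (v w) - D w • v w) (X (u w) - D w • u w)
    nlinarith [sq_nonneg (‖X (v w) - D w • v w‖ - ‖X (u w) - D w • u w‖)]
  rw [← Finset.sum_div, Finset.sum_add_distrib] at hyoung
  linarith

end Families

section Damping

open scoped RealInnerProductSpace

variable {H : Type*} [NormedAddCommGroup H] [InnerProductSpace ℝ H]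
variable {ι : Type*} [Fintype ι]

lemma exists_damped [DecidableEq ι] {L : ℝ} (hL : 0 < L) (u : ι → H)
    (N : EuclideanSpace ℝ ι →ₗ[ℝ] EuclideanSpace ℝ ι) (hN : ∀ x y, ⟪N x, y⟫ = ⟪x, N y⟫)
    (hT : ∀ c : EuclideanSpace ℝ ι, ‖∑ w, c w • u w‖ ^ 2 ≤ L * (‖c‖ ^ 2 + ⟪c, N c⟫)) :
    ∃ W : ι → H, SynthesisBound (2 * L) W ∧
      ∑ w, ‖W w - u w‖ ^ 2 ≤ L * ∑ w, ‖N (EuclideanSpace.single w 1)‖ ^ 2 := by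
  set P : EuclideanSpace ℝ ι →ₗ[ℝ] EuclideanSpace ℝ ι := LinearMap.id + N ∘ₗ N with hP
  have hPa : ∀ c, P c = c + N (N c) := fun c => by simp [hP]
  have hPn : ∀ c, ‖P c‖ ^ 2 = ‖c‖ ^ 2 + 2 * ‖N c‖ ^ 2 + ‖N (N c)‖ ^ 2 := by
    intro c
    rw [hPa, norm_add_sq_real, ← hN, real_inner_self_eq_norm_sq]
  have hinj : Function.Injective P := by
    rw [injective_iff_map_eq_zero]
    intro c hc
    have h1 := hPn c
    rw [hc, norm_zero] at h1
    have : ‖c‖ ^ 2 = 0 := by nlinarith [sq_nonneg ‖c‖, sq_nonneg ‖N c‖, sq_nonneg ‖N (N c)‖]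
    simpa using this
  set Q := LinearEquiv.ofInjectiveEndo P hinj with hQ
  have hQP : ∀ c, P (Q.symm c) = c := fun c => by
    have := Q.apply_symm_apply c
    rwa [hQ, LinearEquiv.coe_ofInjectiveEndo] at this
  set T : EuclideanSpace ℝ ι →ₗ[ℝ] H :=
    { toFun := fun c => ∑ w, c w • u w
      map_add' := fun a b => by simp [add_smul, Finset.sum_add_distrib]
      map_smul' := fun a b => by simp [mul_smul, Finset.smul_sum] } with hTdef
  have hTa : ∀ c, T c = ∑ w, c w • u w := fun c => rfl
  have hTs : ∀ w, T (EuclideanSpace.single w 1) = u w := fun w => by simp [hTa]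
  refine ⟨fun w => T (Q.symm (EuclideanSpace.single w 1)), fun c => ?_, ?_⟩
  · have h1 : ∑ w, c w • T (Q.symm (EuclideanSpace.single w 1)) =
        T (Q.symm (WithLp.toLp 2 c)) := by
      simp only [← map_smul, ← map_sum]
      congr 2
      ext i
      simp [Pi.single_apply]
    rw [h1]
    set c' := Q.symm (WithLp.toLp 2 c) with hc'
    have h2 : ∑ w, c w ^ 2 = ‖P c'‖ ^ 2 := by
      rw [hc', hQP, EuclideanSpace.norm_sq_eq]; simp
    have h3 := hT c'
    have h4 := real_inner_le_norm c' (N c')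
    rw [h2, hPn, hTa]
    refine h3.trans ?_
    rw [mul_comm 2 L, mul_assoc]
    refine mul_le_mul_of_nonneg_left ?_ hL.le
    nlinarith [sq_nonneg (‖c'‖ - ‖N c'‖), sq_nonneg ‖N (N c')‖]
  · rw [Finset.mul_sum]
    refine Finset.sum_le_sum fun w _ => ?_
    set e : EuclideanSpace ℝ ι := EuclideanSpace.single w 1 with he
    set c' := Q.symm e with hc'
    have h1 : c' + N (N c') = e := by rw [← hPa, hc', hQP]
    have h2 : T c' - u w = - T (N (N c')) := by
      rw [← hTs w, ← he, ← h1, map_add]; abel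
    have h3 : ‖N e‖ ^ 2 = ‖N c'‖ ^ 2 + 2 * ‖N (N c')‖ ^ 2 + ‖N (N (N c'))‖ ^ 2 := by
      rw [← hPn (N c'), hPa, ← h1, map_add]
    rw [h2, norm_neg, hTa]
    refine (hT _).trans ?_
    rw [h3]
    refine mul_le_mul_of_nonneg_left ?_ hL.le
    have h4 := real_inner_le_norm (N (N c')) (N (N (N c')))
    nlinarith [sq_nonneg (‖N (N c')‖ - ‖N (N (N c'))‖), sq_nonneg ‖N c'‖]

variable {β κ δ : Type*} [Fintype β] [Fintype κ] [Fintype δ]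

lemma SynthesisBound.of_slices {L : ℝ} {u : β × κ → H}
    (hu : ∀ b, SynthesisBound L fun k => u (b, k)) :
    SynthesisBound (Fintype.card β * L) u := by
  intro c
  rw [Fintype.sum_prod_type, Fintype.sum_prod_type]
  have h1 : ‖∑ b, ∑ k, c (b, k) • u (b, k)‖ ^ 2 ≤
      Fintype.card β * ∑ b, ‖∑ k, c (b, k) • u (b, k)‖ ^ 2 := by
    calc _ ≤ (∑ b, ‖∑ k, c (b, k) • u (b, k)‖) ^ 2 := by gcongr; exact norm_sum_le _ _
      _ ≤ _ := sq_sum_le_card_mul_sum_sq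
  refine h1.trans ?_
  rw [mul_assoc, Finset.mul_sum _ _ L]
  gcongr with b
  exact hu b _

/-- Off-diagonal Gram entries are controlled by the approximate joint eigenvalue data. -/
lemma sum_offDiag_gram_le {κ' : ℝ} (hκ' : 0 ≤ κ') {u : ι → H} (hu : SynthesisBound κ' u)
    (X : δ → H →L[ℝ] H) (hX : ∀ i x y, ⟪X i x, y⟫ = ⟪x, X i y⟫) (D : δ → ι → ℝ) :
    ∑ i, ∑ w, ∑ w', ((D i w - D i w') * ⟪u w, u w'⟫) ^ 2 ≤
      4 * κ' * ∑ i, ∑ w, ‖X i (u w) - D i w • u w‖ ^ 2 := by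
  rw [Finset.mul_sum]
  refine Finset.sum_le_sum fun i _ => ?_
  set r : ι → H := fun w => X i (u w) - D i w • u w with hr
  have h1 : ∀ w w', (D i w - D i w') * ⟪u w, u w'⟫ = ⟪u w, r w'⟫ - ⟪u w', r w⟫ := by
    intro w w'
    simp only [hr, inner_sub_right, real_inner_smul_right]
    rw [← hX, real_inner_comm (X i (u w)) (u w'), real_inner_comm (u w) (u w')]
    ring
  have h2 : ∀ w w', ((D i w - D i w') * ⟪u w, u w'⟫) ^ 2 ≤
      2 * ⟪u w, r w'⟫ ^ 2 + 2 * ⟪u w', r w⟫ ^ 2 := by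
    intro w w'
    rw [h1]; nlinarith [sq_nonneg (⟪u w, r w'⟫ + ⟪u w', r w⟫)]
  have h3 : ∑ w, ∑ w', ⟪u w', r w⟫ ^ 2 ≤ κ' * ∑ w, ‖r w‖ ^ 2 := by
    rw [Finset.mul_sum]
    exact Finset.sum_le_sum fun w _ => hu.bessel hκ' (r w)
  have h4 : ∑ w, ∑ w', ⟪u w, r w'⟫ ^ 2 ≤ κ' * ∑ w, ‖r w‖ ^ 2 := by
    rw [Finset.sum_comm]; exact h3
  calc _ ≤ ∑ w, ∑ w', (2 * ⟪u w, r w'⟫ ^ 2 + 2 * ⟪u w', r w⟫ ^ 2) :=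
        Finset.sum_le_sum fun w _ => Finset.sum_le_sum fun w' _ => h2 w w'
    _ = 2 * ∑ w, ∑ w', ⟪u w, r w'⟫ ^ 2 + 2 * ∑ w, ∑ w', ⟪u w', r w⟫ ^ 2 := by
        simp only [Finset.sum_add_distrib, Finset.mul_sum]
    _ ≤ _ := by linarith

lemma exists_damped_of_slices {L γ R : ℝ} (hL : 0 < L) (hγ : 0 < γ) {u : β × κ → H}
    (hu : ∀ b, SynthesisBound L fun k => u (b, k))
    (X : δ → H →L[ℝ] H) (hX : ∀ i x y, ⟪X i x, y⟫ = ⟪x, X i y⟫) (D : δ → β × κ → ℝ)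
    (hR : ∑ i, ∑ w, ‖X i (u w) - D i w • u w‖ ^ 2 ≤ R)
    (hD : ∀ w w' : β × κ, w.1 ≠ w'.1 → γ ^ 2 ≤ ∑ i, (D i w - D i w') ^ 2) :
    ∃ W : β × κ → H, SynthesisBound (2 * L) W ∧
      ∑ w, ‖W w - u w‖ ^ 2 ≤ 4 * Fintype.card β * R / γ ^ 2 := by
  classical
  set E : Matrix (β × κ) (β × κ) ℝ :=
    fun w w' => if w.1 = w'.1 then 0 else ⟪u w, u w'⟫ / L with hE
  have hEsymm : ∀ w w', E w w' = E w' w := fun w w' => by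
    simp only [hE, eq_comm (a := w.1), real_inner_comm (u w)]
  set N := Matrix.toEuclideanLin E with hNdef
  have hNa : ∀ x w, N x w = ∑ w', E w w' * x w' := fun x w => by
    simp [hNdef, Matrix.mulVec, dotProduct]
  have hNs : ∀ x y, ⟪N x, y⟫ = ⟪x, N y⟫ := by
    intro x y
    simp only [PiLp.inner_apply, hNa, RCLike.inner_apply, conj_trivial, Finset.mul_sum,
      Finset.sum_mul]
    rw [Finset.sum_comm]
    refine Finset.sum_congr rfl fun w _ => Finset.sum_congr rfl fun w' _ => ?_
    rw [hEsymm w' w]; ring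
  have hT : ∀ c : EuclideanSpace ℝ (β × κ),
      ‖∑ w, c w • u w‖ ^ 2 ≤ L * (‖c‖ ^ 2 + ⟪c, N c⟫) := by
    intro c
    set h : β → H := fun b => ∑ k, c (b, k) • u (b, k) with hh
    have h1 : ‖∑ w, c w • u w‖ ^ 2 = ∑ b, ∑ b', ⟪h b, h b'⟫ := by
      rw [Fintype.sum_prod_type, ← real_inner_self_eq_norm_sq, sum_inner]
      simp only [inner_sum, hh]
    have h2 : L * ⟪c, N c⟫ = ∑ b, ∑ b', if b = b' then 0 else ⟪h b, h b'⟫ := by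
      simp only [PiLp.inner_apply, hNa, RCLike.inner_apply, conj_trivial, Finset.mul_sum,
        Finset.sum_mul, Fintype.sum_prod_type]
      refine Finset.sum_congr rfl fun b _ => ?_
      rw [Finset.sum_comm]
      refine Finset.sum_congr rfl fun b' _ => ?_
      split_ifs with hb
      · subst hb; simp [hE]
      · simp only [hh, sum_inner, inner_sum, real_inner_smul_left, real_inner_smul_right]
        rw [Finset.sum_comm]
        refine Finset.sum_congr rfl fun k _ => Finset.sum_congr rfl fun k' _ => ?_
        simp only [hE, hb, if_false]
        field_simp
    have h3 : ∑ b, ‖h b‖ ^ 2 ≤ L * ‖c‖ ^ 2 := by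
      rw [EuclideanSpace.norm_sq_eq, Fintype.sum_prod_type, Finset.mul_sum]
      refine Finset.sum_le_sum fun b _ => ?_
      simpa using hu b fun k => c (b, k)
    rw [mul_add, h1, h2]
    have h4 : ∑ b, ∑ b', ⟪h b, h b'⟫ =
        ∑ b, ‖h b‖ ^ 2 + ∑ b, ∑ b', (if b = b' then 0 else ⟪h b, h b'⟫) := by
      rw [← Finset.sum_add_distrib]
      refine Finset.sum_congr rfl fun b _ => ?_
      have : ‖h b‖ ^ 2 = ∑ b', if b = b' then ⟪h b, h b'⟫ else 0 := by
        simp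
      rw [this, ← Finset.sum_add_distrib]
      refine Finset.sum_congr rfl fun b' _ => ?_
      split_ifs <;> simp
    rw [h4]
    linarith
  obtain ⟨W, hW, hWu⟩ := exists_damped hL u N hNs hT
  refine ⟨W, hW, hWu.trans ?_⟩
  have h5 : ∑ w, ‖N (EuclideanSpace.single w 1)‖ ^ 2 = ∑ w, ∑ w', E w' w ^ 2 := by
    refine Finset.sum_congr rfl fun w _ => ?_
    rw [EuclideanSpace.norm_sq_eq]
    refine Finset.sum_congr rfl fun w' _ => ?_
    rw [hNa]; simp
  have h6 := sum_offDiag_gram_le (by positivity) (SynthesisBound.of_slices hu) X hX D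
  have h7 : γ ^ 2 * L ^ 2 * ∑ w, ∑ w', E w' w ^ 2 ≤
      ∑ i, ∑ w, ∑ w', ((D i w - D i w') * ⟪u w, u w'⟫) ^ 2 := by
    rw [Finset.sum_comm (s := (Finset.univ : Finset δ)), Finset.mul_sum]
    refine Finset.sum_le_sum fun w _ => ?_
    rw [Finset.sum_comm, Finset.mul_sum]
    refine Finset.sum_le_sum fun w' _ => ?_
    rw [hEsymm]
    simp only [hE]
    split_ifs with hww
    · simpa using Finset.sum_nonneg fun i _ => sq_nonneg _
    · simp only [mul_pow, ← Finset.sum_mul]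
      have := hD w w' hww
      calc γ ^ 2 * L ^ 2 * (⟪u w, u w'⟫ / L) ^ 2 = γ ^ 2 * ⟪u w, u w'⟫ ^ 2 := by field_simp
        _ ≤ _ := by gcongr
  rw [h5, le_div_iff₀ (by positivity)]
  have h8 : L * (L * (∑ w, ∑ w', E w' w ^ 2) * γ ^ 2) ≤ L * (4 * Fintype.card β * R) := by
    calc _ = γ ^ 2 * L ^ 2 * ∑ w, ∑ w', E w' w ^ 2 := by ring
      _ ≤ _ := h7.trans h6
      _ ≤ 4 * (Fintype.card β * L) * R := by gcongr
      _ = _ := by ring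
  exact le_of_mul_le_mul_left h8 hL

end Damping

section Trees

open scoped RealInnerProductSpace

/-- Leaves of the complete `β`-ary tree of depth `J`. -/
def TreeLeaf (β : Type) : ℕ → Type
  | 0 => Unit
  | J + 1 => β × TreeLeaf β J

instance treeLeafFintype (β : Type) [Fintype β] : (J : ℕ) → Fintype (TreeLeaf β J)
  | 0 => inferInstanceAs (Fintype Unit)
  | J + 1 =>
    letI := treeLeafFintype β J
    inferInstanceAs (Fintype (β × TreeLeaf β J))

lemma card_treeLeaf (β : Type) [Fintype β] (J : ℕ) :
    Fintype.card (TreeLeaf β J) = Fintype.card β ^ J := by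
  induction J with
  | zero => exact Fintype.card_unit
  | succ J ih =>
    rw [pow_succ', ← ih]
    exact Fintype.card_prod β (TreeLeaf β J)

variable {H : Type*} [NormedAddCommGroup H] [InnerProductSpace ℝ H]
variable {β δ : Type} [Fintype β] [Fintype δ]

/-- At every node of the tree the leaf vectors are approximate joint eigenvectors of symmetric
operators, with joint eigenvalues separating the children of the node. -/
def TreeData (δ : Type) [Fintype δ] (τ : ℝ) : (J : ℕ) → (TreeLeaf β J → H) → Prop
  | 0, _ => True
  | J + 1, v =>
    (∃ γ : ℝ, 0 < γ ∧ ∃ X : δ → H →L[ℝ] H, (∀ i x y, ⟪X i x, y⟫ = ⟪x, X i y⟫) ∧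
      ∃ D : δ → β × TreeLeaf β J → ℝ,
        (∀ w, ∑ i, ‖X i (v w) - D i w • v w‖ ^ 2 ≤ τ * γ ^ 2) ∧
        ∀ w w' : β × TreeLeaf β J, w.1 ≠ w'.1 → γ ^ 2 ≤ ∑ i, (D i w - D i w') ^ 2) ∧
    ∀ b, TreeData δ τ J fun w => v (b, w)

theorem TreeData.exists_family [FiniteDimensional ℝ H] {τ : ℝ} (J : ℕ) (v : TreeLeaf β J → H)
    (hv : ∀ w, ‖v w‖ = 1) (hT : TreeData δ τ J v) :
    ∃ u : TreeLeaf β J → H, SynthesisBound (2 ^ J) u ∧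
      ∑ w, ‖u w - v w‖ ^ 2 ≤
        8 * Fintype.card β * τ * (2 ^ J - 1) * Fintype.card (TreeLeaf β J) ∧
      ∀ X : H →L[ℝ] H, (∀ x y, ⟪X x, y⟫ = ⟪x, X y⟫) → ∀ D : TreeLeaf β J → ℝ,
        ∑ w, ‖X (u w) - D w • u w‖ ^ 2 ≤ ∑ w, ‖X (v w) - D w • v w‖ ^ 2 := by
  induction J with
  | zero =>
    refine ⟨v, fun c => ?_, by simp, fun X hX D => le_rfl⟩
    let : Unique (TreeLeaf β 0) := inferInstanceAs (Unique Unit)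
    rw [Fintype.sum_unique, Fintype.sum_unique, norm_smul, hv, mul_one, Real.norm_eq_abs, sq_abs]
    simp
  | succ J ih =>
    obtain ⟨⟨γ, hγ, X, hX, D, hXD, hD⟩, hchild⟩ := hT
    choose U hU hUv hUX using fun b => ih (fun w => v (b, w)) (fun w => hv _) (hchild b)
    set n := Fintype.card (TreeLeaf β J) with hn
    have hcard : Fintype.card (TreeLeaf β (J + 1)) = Fintype.card β * n :=
      Fintype.card_prod β (TreeLeaf β J)
    set u₀ : β × TreeLeaf β J → H := fun w => U w.1 w.2 with hu₀
    have hR : ∑ i, ∑ w, ‖X i (u₀ w) - D i w • u₀ w‖ ^ 2 ≤ τ * γ ^ 2 * (Fintype.card β * n) := by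
      calc ∑ i, ∑ w, ‖X i (u₀ w) - D i w • u₀ w‖ ^ 2
          ≤ ∑ i, ∑ w : β × TreeLeaf β J, ‖X i (v w) - D i w • v w‖ ^ 2 := by
            refine Finset.sum_le_sum fun i _ => ?_
            rw [Fintype.sum_prod_type, Fintype.sum_prod_type]
            exact Finset.sum_le_sum fun b _ => hUX b (X i) (hX i) fun w => D i (b, w)
        _ = ∑ w : β × TreeLeaf β J, ∑ i, ‖X i (v w) - D i w • v w‖ ^ 2 := Finset.sum_comm
        _ ≤ ∑ w : β × TreeLeaf β J, τ * γ ^ 2 := Finset.sum_le_sum fun w _ => hXD w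
        _ = _ := by
            rw [Finset.sum_const, Finset.card_univ, Fintype.card_prod, nsmul_eq_mul]
            push_cast; ring
    obtain ⟨W, hW, hWu⟩ := exists_damped_of_slices (u := u₀) (by positivity : (0:ℝ) < 2 ^ J) hγ
      hU X hX D hR hD
    rw [← pow_succ'] at hW
    obtain ⟨u, hu, huv, hcon⟩ := exists_contracting (κ := 2 ^ (J + 1)) (by positivity)
      (v : β × TreeLeaf β J → H) W hW
    refine ⟨u, hu, huv.trans ?_, hcon⟩
    have h1 : ∑ w : β × TreeLeaf β J, ‖W w - v w‖ ^ 2 ≤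
        2 * ∑ w, ‖W w - u₀ w‖ ^ 2 + 2 * ∑ w : β × TreeLeaf β J, ‖u₀ w - v w‖ ^ 2 := by
      rw [Finset.mul_sum, Finset.mul_sum, ← Finset.sum_add_distrib]
      refine Finset.sum_le_sum fun w _ => ?_
      have h2 : ‖W w - v w‖ ≤ ‖W w - u₀ w‖ + ‖u₀ w - v w‖ := norm_sub_le_norm_sub_add_norm_sub ..
      nlinarith [sq_nonneg (‖W w - u₀ w‖ - ‖u₀ w - v w‖), norm_nonneg (W w - v w)]
    have h3 : ∑ w : β × TreeLeaf β J, ‖u₀ w - v w‖ ^ 2 ≤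
        Fintype.card β * (8 * Fintype.card β * τ * (2 ^ J - 1) * n) := by
      rw [Fintype.sum_prod_type]
      refine (Finset.sum_le_sum fun b _ => hUv b).trans_eq ?_
      rw [Finset.sum_const, Finset.card_univ, nsmul_eq_mul]
    refine h1.trans ?_
    have h4 : 4 * Fintype.card β * (τ * γ ^ 2 * (Fintype.card β * n)) / γ ^ 2
        = 4 * Fintype.card β * τ * (Fintype.card β * n) := by field_simp
    rw [h4] at hWu
    rw [hcard]
    push_cast
    rw [pow_succ]
    linarith

/-- Dimension bound for trees of approximate joint eigenvectors. -/
theorem TreeData.card_le [FiniteDimensional ℝ H] {τ : ℝ} (hτ : 0 ≤ τ) {J : ℕ}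
    {v : TreeLeaf β J → H} (hv : ∀ w, ‖v w‖ = 1) (hT : TreeData δ τ J v)
    (hsmall : 32 * Fintype.card β * τ * 2 ^ J ≤ 1) :
    (Fintype.card β : ℝ) ^ J ≤ 2 ^ (J + 2) * Module.finrank ℝ H := by
  obtain ⟨u, hu, huv, -⟩ := hT.exists_family J v hv
  set n : ℝ := ((Fintype.card (TreeLeaf β J) : ℕ) : ℝ) with hn
  have hn' : n = (Fintype.card β : ℝ) ^ J := by rw [hn, card_treeLeaf]; push_cast; rfl
  rw [← hn']
  have hn0 : 0 ≤ n := by rw [hn]; positivity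
  set b := stdOrthonormalBasis ℝ H with hb
  have h1 : ∑ w, ‖u w‖ ^ 2 ≤ 2 ^ J * Module.finrank ℝ H := by
    have h2 : ∀ w, ‖u w‖ ^ 2 = ∑ i, ⟪u w, b i⟫ ^ 2 := fun w => by
      rw [← b.sum_sq_norm_inner_left (u w)]
      simp
    simp only [h2]
    rw [Finset.sum_comm]
    calc _ ≤ ∑ i, 2 ^ J * ‖b i‖ ^ 2 := Finset.sum_le_sum fun i _ => hu.bessel (by positivity) _
      _ = _ := by simp [mul_comm]
  have h3 : n ≤ 2 * ∑ w, ‖u w‖ ^ 2 + 2 * ∑ w, ‖u w - v w‖ ^ 2 := by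
    have : n = ∑ w : TreeLeaf β J, (1 : ℝ) := by simp [hn]
    rw [this, Finset.mul_sum, Finset.mul_sum, ← Finset.sum_add_distrib]
    refine Finset.sum_le_sum fun w _ => ?_
    have h4 : (1 : ℝ) ≤ ‖u w‖ + ‖u w - v w‖ := by
      rw [← hv w]; exact norm_le_norm_add_norm_sub _ _
    nlinarith [sq_nonneg (‖u w‖ - ‖u w - v w‖)]
  have h5 : 8 * Fintype.card β * τ * (2 ^ J - 1) * n ≤ 1 / 4 * n := by
    gcongr
    have : 0 ≤ Fintype.card β * τ := by positivity
    nlinarith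
  rw [pow_add]
  linarith

end Trees

section Node

open scoped RealInnerProductSpace

variable {H : Type*} [NormedAddCommGroup H] [InnerProductSpace ℝ H]
variable {d : ℕ}

/-- Cauchy–Schwarz inequality for a form dominated by another one. -/
lemma inner_sq_le_of_abs_le {K T : H →L[ℝ] H} (hK : ∀ x y, ⟪K x, y⟫ = ⟪x, K y⟫)
    (hT : ∀ x y, ⟪T x, y⟫ = ⟪x, T y⟫) {ρ : ℝ} (h : ∀ x, |ρ * ⟪x, T x⟫| ≤ ⟪x, K x⟫) (x y : H) :
    (ρ * ⟪x, T y⟫) ^ 2 ≤ ⟪x, K x⟫ * ⟪y, K y⟫ := by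
  have h1 : ∀ t : ℝ, 0 ≤ (2 * ⟪y, K y⟫) * (t * t) + (-4 * ρ * ⟪x, T y⟫) * t + 2 * ⟪x, K x⟫ := by
    intro t
    have hp := (abs_le.mp (h (x + t • y))).2
    have hm := (abs_le.mp (h (x - t • y))).1
    have e1 : ⟪y, T x⟫ = ⟪x, T y⟫ := by rw [← hT, real_inner_comm]
    have e2 : ⟪y, K x⟫ = ⟪x, K y⟫ := by rw [← hK, real_inner_comm]
    simp only [map_add, map_sub, map_smul, inner_add_left, inner_add_right, inner_sub_left,
      inner_sub_right, real_inner_smul_left, real_inner_smul_right, e1, e2] at hp hm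
    nlinarith
  have h2 := discrim_le_zero h1
  rw [discrim] at h2
  nlinarith

lemma inner_sq_le_of_nonneg {K : H →L[ℝ] H} (hK : ∀ x y, ⟪K x, y⟫ = ⟪x, K y⟫)
    (h : ∀ x, 0 ≤ ⟪x, K x⟫) (x y : H) : ⟪x, K y⟫ ^ 2 ≤ ⟪x, K x⟫ * ⟪y, K y⟫ := by
  have := inner_sq_le_of_abs_le hK hK (ρ := 1) (fun x => by rw [one_mul, abs_of_nonneg (h x)]) x y
  simpa using this

/-- Dual norm estimate for a solution of `N a = t`. -/
lemma inner_le_of_dual {N : H →L[ℝ] H} {E : ℝ} (hE : 0 ≤ E) {a t : H} (ha : N a = t)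
    (h : ⟪a, t⟫ ^ 2 ≤ E * ⟪a, N a⟫) : ⟪a, N a⟫ ≤ E := by
  rw [ha] at h ⊢
  by_contra! hlt
  nlinarith

/-- The gap operator `(|u|² + η) - ∑ u i A i - B`. -/
def gapOp (A : Fin d → H →L[ℝ] H) (B : H →L[ℝ] H) (η : ℝ) (u : Fin d → ℝ) : H →L[ℝ] H :=
  (∑ i, u i ^ 2 + η) • ContinuousLinearMap.id ℝ H - ∑ i, u i • A i - B

/-- Minus the derivative of the gap operator in direction `i`. -/
def slopeOp (A : Fin d → H →L[ℝ] H) (u : Fin d → ℝ) (i : Fin d) : H →L[ℝ] H :=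
  A i - (2 * u i) • ContinuousLinearMap.id ℝ H

variable {A : Fin d → H →L[ℝ] H} {B : H →L[ℝ] H} {η : ℝ}

lemma gapOp_apply (u : Fin d → ℝ) (h : H) :
    gapOp A B η u h = (∑ i, u i ^ 2 + η) • h - ∑ i, u i • A i h - B h := by
  simp [gapOp]

lemma slopeOp_apply (u : Fin d → ℝ) (i : Fin d) (h : H) :
    slopeOp A u i h = A i h - (2 * u i) • h := by
  simp [slopeOp]

lemma gapOp_add (u y : Fin d → ℝ) (h : H) :
    gapOp A B η (u + y) h =
      gapOp A B η u h - ∑ i, y i • slopeOp A u i h + (∑ i, y i ^ 2) • h := by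
  simp only [gapOp_apply, slopeOp_apply, Pi.add_apply, smul_sub, Finset.sum_sub_distrib, add_smul,
    Finset.sum_add_distrib, smul_smul, ← Finset.sum_smul]
  have : ∑ i, (u i + y i) ^ 2 = ∑ i, u i ^ 2 + ∑ i, y i * (2 * u i) + ∑ i, y i ^ 2 := by
    rw [← Finset.sum_add_distrib, ← Finset.sum_add_distrib]
    exact Finset.sum_congr rfl fun i _ => by ring
  rw [this]
  module

lemma gapOp_add_single (u : Fin d → ℝ) (i : Fin d) (a : ℝ) (h : H) :
    gapOp A B η (u + Pi.single i a) h =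
      gapOp A B η u h - a • slopeOp A u i h + a ^ 2 • h := by
  have h1 : ∑ j, (Pi.single i a : Fin d → ℝ) j • slopeOp A u j h = a • slopeOp A u i h := by
    rw [Finset.sum_eq_single i]
    · simp
    · intro j _ hj; simp [hj]
    · simp
  have h2 : ∑ j, (Pi.single i a : Fin d → ℝ) j ^ 2 = a ^ 2 := by
    rw [Finset.sum_eq_single i]
    · simp
    · intro j _ hj; simp [hj]
    · simp
  rw [gapOp_add, h1, h2]

lemma slopeOp_add (u y : Fin d → ℝ) (i : Fin d) (h : H) :
    slopeOp A u i h = slopeOp A (u + y) i h + (2 * y i) • h := by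
  rw [slopeOp_apply, slopeOp_apply, Pi.add_apply]
  module

lemma gapOp_symm (hA : ∀ i x y, ⟪A i x, y⟫ = ⟪x, A i y⟫) (hB : ∀ x y, ⟪B x, y⟫ = ⟪x, B y⟫)
    (u : Fin d → ℝ) (x y : H) : ⟪gapOp A B η u x, y⟫ = ⟪x, gapOp A B η u y⟫ := by
  simp only [gapOp_apply, inner_sub_left, inner_sub_right, real_inner_smul_left,
    real_inner_smul_right, sum_inner, inner_sum, hA, hB]

lemma slopeOp_symm (hA : ∀ i x y, ⟪A i x, y⟫ = ⟪x, A i y⟫)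
    (u : Fin d → ℝ) (i : Fin d) (x y : H) : ⟪slopeOp A u i x, y⟫ = ⟪x, slopeOp A u i y⟫ := by
  simp only [slopeOp_apply, inner_sub_left, inner_sub_right, real_inner_smul_left,
    real_inner_smul_right, hA]

/-- Near-extremality of the unit vector `v` at the point `w`. -/
structure IsLeafVector (A : Fin d → H →L[ℝ] H) (B : H →L[ℝ] H) (η ρ : ℝ) (w : Fin d → ℝ) (v : H) :
    Prop where
  norm_eq : ‖v‖ = 1
  le : ⟪v, gapOp A B η w v⟫ ≤ 3 * η
  add_le : ∀ i h, ρ ^ 2 * ‖h‖ ^ 2 ≤ ⟪h, gapOp A B η (w + Pi.single i ρ) h⟫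
  sub_le : ∀ i h, ρ ^ 2 * ‖h‖ ^ 2 ≤ ⟪h, gapOp A B η (w + Pi.single i (-ρ)) h⟫

set_option maxHeartbeats 1600000 in
/-- At a node with base point `z` and scale `s`, the leaf vectors are approximate joint
eigenvectors of symmetric operators. -/
lemma exists_node_operators [FiniteDimensional ℝ H]
    (hA : ∀ i x y, ⟪A i x, y⟫ = ⟪x, A i y⟫) (hB : ∀ x y, ⟪B x, y⟫ = ⟪x, B y⟫)
    {z : Fin d → ℝ} {s ρ θ : ℝ} (hs : 0 < s) (hρ : 0 < ρ) (hρs : ρ ≤ s) (hθ : 0 ≤ θ)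
    (hη : 3 * η = θ * ρ ^ 2)
    (hz : ∀ h, 0 ≤ ⟪h, gapOp A B η z h⟫)
    (hzp : ∀ i h, 0 ≤ ⟪h, gapOp A B η (z + Pi.single i s) h⟫)
    (hzm : ∀ i h, 0 ≤ ⟪h, gapOp A B η (z + Pi.single i (-s)) h⟫) :
    ∃ X : Fin d → H →L[ℝ] H, (∀ i x y, ⟪X i x, y⟫ = ⟪x, X i y⟫) ∧
      ∀ (y : Fin d → ℝ) (v : H), ∑ i, y i ^ 2 ≤ (s / 4) ^ 2 → IsLeafVector A B η ρ (z + y) v →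
        (∀ h, 0 ≤ ⟪h, gapOp A B η (z + y) h⟫) → (∀ h, 0 ≤ ⟪h, gapOp A B η (z + -y) h⟫) →
        ∑ i, ‖X i v - (2 * y i / (∑ j, y j ^ 2 + s ^ 2) ^ 2) • v‖ ^ 2 ≤
          d * (6 * (4 * d + 5)) * θ / s ^ 6 := by
  set N : H →L[ℝ] H := gapOp A B η z + s ^ 2 • ContinuousLinearMap.id ℝ H with hNdef
  have hNa : ∀ h, N h = gapOp A B η z h + s ^ 2 • h := fun h => by simp [hNdef]
  have hNs : ∀ x y, ⟪N x, y⟫ = ⟪x, N y⟫ := fun x y => by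
    rw [hNa, hNa, inner_add_left, inner_add_right, gapOp_symm hA hB, real_inner_smul_left,
      real_inner_smul_right]
  have hNx : ∀ x, ⟪x, N x⟫ = ⟪x, gapOp A B η z x⟫ + s ^ 2 * ‖x‖ ^ 2 := fun x => by
    rw [hNa, inner_add_right, real_inner_smul_right, real_inner_self_eq_norm_sq]
  have hNlow : ∀ x, s ^ 2 * ‖x‖ ^ 2 ≤ ⟪x, N x⟫ := fun x => by
    rw [hNx]; linarith [hz x]
  have hN0 : ∀ x, 0 ≤ ⟪x, N x⟫ := fun x => le_trans (by positivity) (hNlow x)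
  have hinj : Function.Injective (N : H →ₗ[ℝ] H) := by
    rw [injective_iff_map_eq_zero]
    intro x hx
    have h1 := hNlow x
    have h2 : N x = 0 := hx
    rw [h2, inner_zero_right] at h1
    have h3 : ‖x‖ ^ 2 = 0 := by
      have : 0 < s ^ 2 := by positivity
      nlinarith [sq_nonneg ‖x‖]
    simpa using h3
  set Q := LinearEquiv.ofInjectiveEndo (N : H →ₗ[ℝ] H) hinj with hQ
  set P : H →L[ℝ] H := LinearMap.toContinuousLinearMap (Q.symm : H →ₗ[ℝ] H) with hP
  have hNP : ∀ x, N (P x) = x := fun x => by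
    have := Q.apply_symm_apply x
    rwa [hQ, LinearEquiv.coe_ofInjectiveEndo] at this
  have hPN : ∀ x, P (N x) = x := fun x => by
    have := Q.symm_apply_apply x
    exact this
  have hPs : ∀ x y, ⟪P x, y⟫ = ⟪x, P y⟫ := fun x y => by
    nth_rewrite 1 [← hNP y]
    rw [← hNs, hNP]
  set T := slopeOp A z with hT
  have hTs : ∀ i x y, ⟪T i x, y⟫ = ⟪x, T i y⟫ := slopeOp_symm hA z
  have hTN : ∀ i x, |s * ⟪x, T i x⟫| ≤ ⟪x, N x⟫ := by
    intro i x
    have h1 := hzp i x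
    have h2 := hzm i x
    rw [gapOp_add_single, inner_add_right, inner_sub_right, real_inner_smul_right,
      real_inner_smul_right, real_inner_self_eq_norm_sq] at h1 h2
    rw [abs_le, hNx]
    constructor <;> nlinarith
  have hTN2 : ∀ i x y, (s * ⟪x, T i y⟫) ^ 2 ≤ ⟪x, N x⟫ * ⟪y, N y⟫ := fun i =>
    inner_sq_le_of_abs_le hNs (hTs i) (hTN i)
  refine ⟨fun i => P ∘L T i ∘L P, fun i x y => ?_, fun y v hy hv hyp hym => ?_⟩
  · simp only [ContinuousLinearMap.comp_apply]
    rw [hPs, hTs, hPs]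
  set w := z + y with hw
  set Y := ∑ j, y j ^ 2 with hY
  have hY0 : 0 ≤ Y := Finset.sum_nonneg fun _ _ => sq_nonneg _
  set μ := Y + s ^ 2 with hμ
  have hμs : s ^ 2 ≤ μ := by rw [hμ]; linarith
  have hμ0 : 0 < μ := lt_of_lt_of_le (by positivity) hμs
  -- upper bound of the gap operator at the leaf by `N`
  have hKw : ∀ x, ⟪x, gapOp A B η w x⟫ ≤ 2 * ⟪x, N x⟫ := by
    intro x
    have h1 := hym x
    rw [hw, gapOp_add]
    rw [gapOp_add] at h1
    simp only [inner_add_right, inner_sub_right, inner_sum, real_inner_smul_right, Pi.neg_apply,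
      neg_mul, Finset.sum_neg_distrib, neg_sq, real_inner_self_eq_norm_sq] at h1 ⊢
    rw [hNx]
    have : Y * ‖x‖ ^ 2 ≤ s ^ 2 * ‖x‖ ^ 2 := by
      gcongr; nlinarith
    linarith
  have hfac : ∀ x, ⟪x, gapOp A B η w v⟫ ^ 2 ≤ 2 * θ * s ^ 2 * ⟪x, N x⟫ := by
    intro x
    have h1 := inner_sq_le_of_nonneg (gapOp_symm hA hB w) hyp x v
    have h2 : ρ ^ 2 ≤ s ^ 2 := by gcongr
    calc _ ≤ _ := h1
      _ ≤ (2 * ⟪x, N x⟫) * (θ * ρ ^ 2) :=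
          mul_le_mul (hKw x) (hη ▸ hv.le) (hyp v) (by linarith [hN0 x])
      _ ≤ (2 * ⟪x, N x⟫) * (θ * s ^ 2) := by
          have := hN0 x
          gcongr
      _ = _ := by ring
  have hslope : ∀ i x, ⟪x, slopeOp A w i v⟫ ^ 2 ≤ 2 * θ * ⟪x, N x⟫ := by
    intro i x
    have h0 : ∀ h, |ρ * ⟪h, slopeOp A w i h⟫| ≤ ⟪h, gapOp A B η w h⟫ := by
      intro h
      have h1 := hv.add_le i h
      have h2 := hv.sub_le i h
      rw [gapOp_add_single, inner_add_right, inner_sub_right, real_inner_smul_right,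
        real_inner_smul_right, real_inner_self_eq_norm_sq] at h1 h2
      rw [abs_le]
      constructor <;> nlinarith
    have h1 := inner_sq_le_of_abs_le (gapOp_symm hA hB w) (slopeOp_symm hA w i) h0 x v
    have h2 : (ρ * ⟪x, slopeOp A w i v⟫) ^ 2 ≤ (2 * ⟪x, N x⟫) * (θ * ρ ^ 2) :=
      h1.trans (mul_le_mul (hKw x) (hη ▸ hv.le) (hyp v) (by linarith [hN0 x]))
    have h3 : ρ ^ 2 * ⟪x, slopeOp A w i v⟫ ^ 2 ≤ ρ ^ 2 * (2 * θ * ⟪x, N x⟫) := by linarith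
    exact le_of_mul_le_mul_left h3 (by positivity)
  set g := N v - μ • v with hg
  have hgexp : g = gapOp A B η w v + ∑ i, y i • slopeOp A w i v := by
    have h1 := gapOp_add (A := A) (B := B) (η := η) w (-y) v
    rw [hw, add_neg_cancel_right, ← hw] at h1
    rw [hg, hNa, h1]
    simp only [Pi.neg_apply, neg_smul, Finset.sum_neg_distrib, neg_sq, hμ]
    module
  set C₁ : ℝ := 4 * (d + 1) with hC₁
  have hC₁0 : 0 ≤ C₁ := by positivity
  have hgN : ∀ x, ⟪x, g⟫ ^ 2 ≤ C₁ * θ * s ^ 2 * ⟪x, N x⟫ := by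
    intro x
    rw [hgexp, inner_add_right, inner_sum]
    simp only [real_inner_smul_right]
    have h1 : (∑ i, y i * ⟪x, slopeOp A w i v⟫) ^ 2 ≤ d * (Y * (2 * θ * ⟪x, N x⟫)) := by
      calc _ ≤ (d : ℝ) * ∑ i, (y i * ⟪x, slopeOp A w i v⟫) ^ 2 := by
            simpa using sq_sum_le_card_mul_sum_sq (s := Finset.univ)
              (f := fun i => y i * ⟪x, slopeOp A w i v⟫)
        _ ≤ _ := by
            rw [hY, Finset.sum_mul]
            gcongr with i
            rw [mul_pow]
            gcongr
            exact hslope i x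
    have h2 : (d : ℝ) * (Y * (2 * θ * ⟪x, N x⟫)) ≤ d * (s ^ 2 * (2 * θ * ⟪x, N x⟫)) := by
      have := hN0 x
      gcongr
      nlinarith
    have h3 := hfac x
    have h4 : ∀ a b : ℝ, (a + b) ^ 2 ≤ 2 * a ^ 2 + 2 * b ^ 2 := fun a b => by
      nlinarith [sq_nonneg (a - b)]
    refine (h4 _ _).trans ?_
    rw [hC₁]
    linarith
  set g' := P g with hg'
  have hNg' : ⟪g', N g'⟫ ≤ C₁ * θ * s ^ 2 :=
    inner_le_of_dual (by positivity) (hNP g) (hgN g')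
  have hPv : P v = μ⁻¹ • (v - g') := by
    have : v - g' = μ • P v := by
      rw [hg', hg, map_sub, hPN, map_smul]; abel
    rw [this, inv_smul_smul₀ hμ0.ne']
  have hs2 : 0 < s ^ 2 := by positivity
  have hbound : ∀ i, ‖(P ∘L T i ∘L P) v - (2 * y i / μ ^ 2) • v‖ ^ 2 ≤
      (6 * (4 * d + 5)) * θ / s ^ 6 := by
    intro i
    set a := P (slopeOp A w i v) with ha
    set b := P (T i g') with hb
    have hPTv : P (T i v) = a + (2 * y i) • μ⁻¹ • (v - g') := by
      rw [hT, slopeOp_add z y i v, map_add, map_smul, hPv]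
    have h1 : (P ∘L T i ∘L P) v - (2 * y i / μ ^ 2) • v =
        μ⁻¹ • (a - (2 * y i / μ) • g' - b) := by
      simp only [ContinuousLinearMap.comp_apply]
      rw [hPv, map_smul, map_sub, map_smul, map_sub, hPTv, ← hb]
      have : (2 * y i / μ ^ 2) = μ⁻¹ * ((2 * y i) * μ⁻¹) := by field_simp
      rw [this, div_eq_mul_inv]
      module
    have hNa' : ⟪a, N a⟫ ≤ 2 * θ := inner_le_of_dual (by positivity) (hNP _) (hslope i a)
    have hNb : ⟪b, N b⟫ ≤ C₁ * θ := by
      refine inner_le_of_dual (by positivity) (hNP _) ?_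
      have h2 := hTN2 i b g'
      have h3 : s ^ 2 * ⟪b, T i g'⟫ ^ 2 ≤ s ^ 2 * (C₁ * θ * ⟪b, N b⟫) := by
        calc _ = (s * ⟪b, T i g'⟫) ^ 2 := by ring
          _ ≤ _ := h2
          _ ≤ ⟪b, N b⟫ * (C₁ * θ * s ^ 2) := by
            have := hN0 b
            gcongr
          _ = _ := by ring
      exact le_of_mul_le_mul_left h3 hs2
    have na : s ^ 2 * ‖a‖ ^ 2 ≤ 2 * θ := (hNlow a).trans hNa'
    have nb : s ^ 2 * ‖b‖ ^ 2 ≤ C₁ * θ := (hNlow b).trans hNb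
    have ng : ‖g'‖ ^ 2 ≤ C₁ * θ := by
      have : s ^ 2 * ‖g'‖ ^ 2 ≤ s ^ 2 * (C₁ * θ) := by
        refine (hNlow g').trans (hNg'.trans_eq (by ring))
      exact le_of_mul_le_mul_left this hs2
    have hyi : s ^ 2 * (2 * y i / μ) ^ 2 ≤ 1 / 4 := by
      have h2 : y i ^ 2 ≤ (s / 4) ^ 2 :=
        (Finset.single_le_sum (f := fun i => y i ^ 2) (fun _ _ => sq_nonneg _)
          (Finset.mem_univ i)).trans hy
      have h3 : s ^ 2 * s ^ 2 ≤ μ * μ := by gcongr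
      rw [div_pow, ← mul_div_assoc, div_le_iff₀ (by positivity)]
      nlinarith
    have h5 : s ^ 2 * ‖a - (2 * y i / μ) • g' - b‖ ^ 2 ≤ 6 * (4 * d + 5) * θ := by
      have h6 : ‖a - (2 * y i / μ) • g' - b‖ ≤ ‖a‖ + ‖(2 * y i / μ) • g'‖ + ‖b‖ :=
        (norm_sub_le _ _).trans (by gcongr; exact norm_sub_le _ _)
      have h7 : ‖a - (2 * y i / μ) • g' - b‖ ^ 2 ≤
          3 * (‖a‖ ^ 2 + ‖(2 * y i / μ) • g'‖ ^ 2 + ‖b‖ ^ 2) := by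
        refine (pow_le_pow_left₀ (norm_nonneg _) h6 2).trans ?_
        nlinarith [sq_nonneg (‖a‖ - ‖b‖), sq_nonneg (‖a‖ - ‖(2 * y i / μ) • g'‖),
          sq_nonneg (‖b‖ - ‖(2 * y i / μ) • g'‖)]
      have h8 : s ^ 2 * ‖(2 * y i / μ) • g'‖ ^ 2 ≤ 1 / 4 * (C₁ * θ) := by
        rw [norm_smul, mul_pow, Real.norm_eq_abs, sq_abs, ← mul_assoc]
        exact mul_le_mul hyi ng (sq_nonneg _) (by norm_num)
      have h9 : s ^ 2 * ‖a - (2 * y i / μ) • g' - b‖ ^ 2 ≤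
          s ^ 2 * (3 * (‖a‖ ^ 2 + ‖(2 * y i / μ) • g'‖ ^ 2 + ‖b‖ ^ 2)) := by gcongr
      have h10 : 0 ≤ d * θ := by positivity
      have h11 : C₁ * θ = 4 * (d * θ) + 4 * θ := by rw [hC₁]; ring
      linarith
    rw [h1, norm_smul, mul_pow, Real.norm_eq_abs, sq_abs, le_div_iff₀ (by positivity)]
    have h12 : μ⁻¹ ^ 2 * s ^ 4 ≤ 1 := by
      rw [inv_pow, inv_mul_le_one₀ (by positivity)]
      nlinarith
    calc μ⁻¹ ^ 2 * ‖a - (2 * y i / μ) • g' - b‖ ^ 2 * s ^ 6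
        = (μ⁻¹ ^ 2 * s ^ 4) * (s ^ 2 * ‖a - (2 * y i / μ) • g' - b‖ ^ 2) := by ring
      _ ≤ 1 * (s ^ 2 * ‖a - (2 * y i / μ) • g' - b‖ ^ 2) := by gcongr
      _ ≤ _ := by rw [one_mul]; exact h5
  refine (Finset.sum_le_sum fun i _ => hbound i).trans_eq ?_
  rw [Finset.sum_const, Finset.card_univ, Fintype.card_fin, nsmul_eq_mul]
  ring

/-- The map `y ↦ 2 y / (|y|² + s²)²` is expanding near the origin. -/
lemma norm_sub_le_stereographic {E : Type*} [NormedAddCommGroup E] [NormedSpace ℝ E] {s : ℝ}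
    (hs : 0 < s) {y y' : E} (hy : ‖y‖ ≤ s / 4) (hy' : ‖y'‖ ≤ s / 4) :
    ‖y - y'‖ ≤ s ^ 4 *
      ‖(2 / (‖y‖ ^ 2 + s ^ 2) ^ 2) • y - (2 / (‖y'‖ ^ 2 + s ^ 2) ^ 2) • y'‖ := by
  set μ := ‖y‖ ^ 2 + s ^ 2 with hμ
  set μ' := ‖y'‖ ^ 2 + s ^ 2 with hμ'
  have hs2 : 0 < s ^ 2 := by positivity
  have m1 : s ^ 2 ≤ μ := by rw [hμ]; nlinarith [sq_nonneg ‖y‖]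
  have m1' : s ^ 2 ≤ μ' := by rw [hμ']; nlinarith [sq_nonneg ‖y'‖]
  have m2 : μ ≤ 17 / 16 * s ^ 2 := by rw [hμ]; nlinarith [norm_nonneg y]
  have m2' : μ' ≤ 17 / 16 * s ^ 2 := by rw [hμ']; nlinarith [norm_nonneg y']
  have hμ0 : 0 < μ := by linarith
  have hμ0' : 0 < μ' := by linarith
  set l := (2 / μ ^ 2) • y with hl
  set l' := (2 / μ' ^ 2) • y' with hl'
  have e1 : y - y' = (μ ^ 2 / 2) • (l - l') + ((μ ^ 2 - μ' ^ 2) / 2) • l' := by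
    have h1 : (μ ^ 2 / 2) • l = y := by
      rw [hl, smul_smul]
      have : μ ^ 2 / 2 * (2 / μ ^ 2) = 1 := by field_simp
      rw [this, one_smul]
    have h2 : (μ' ^ 2 / 2) • l' = y' := by
      rw [hl', smul_smul]
      have : μ' ^ 2 / 2 * (2 / μ' ^ 2) = 1 := by field_simp
      rw [this, one_smul]
    nth_rewrite 1 [← h1, ← h2]
    module
  have h3 : ‖y - y'‖ ≤ μ ^ 2 / 2 * ‖l - l'‖ + |μ ^ 2 - μ' ^ 2| / 2 * ‖l'‖ := by
    nth_rewrite 1 [e1]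
    refine (norm_add_le _ _).trans_eq ?_
    rw [norm_smul, norm_smul, Real.norm_eq_abs, Real.norm_eq_abs, abs_div, abs_div, abs_two,
      abs_of_nonneg (sq_nonneg μ)]
  have h4 : |μ ^ 2 - μ' ^ 2| ≤ 17 / 16 * s ^ 3 * ‖y - y'‖ := by
    have h5 : μ ^ 2 - μ' ^ 2 = (μ + μ') * ((‖y‖ + ‖y'‖) * (‖y‖ - ‖y'‖)) := by
      rw [hμ, hμ']; ring
    rw [h5, abs_mul, abs_mul, abs_of_pos (by positivity : 0 < μ + μ'),
      abs_of_nonneg (by positivity : 0 ≤ ‖y‖ + ‖y'‖)]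
    calc _ ≤ (17 / 8 * s ^ 2) * ((s / 2) * ‖y - y'‖) := by
          gcongr
          · linarith
          · linarith
          · exact abs_norm_sub_norm_le _ _
      _ = _ := by ring
  have h6 : s ^ 3 * ‖l'‖ ≤ 1 / 2 := by
    rw [hl', norm_smul, Real.norm_eq_abs, abs_of_pos (by positivity)]
    have : s ^ 3 * (2 / μ' ^ 2 * ‖y'‖) = (2 * s ^ 3 * ‖y'‖) / μ' ^ 2 := by ring
    rw [this, div_le_iff₀ (by positivity)]
    have h7 : s ^ 2 * s ^ 2 ≤ μ' * μ' := by gcongr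
    have h8 : s ^ 3 * ‖y'‖ ≤ s ^ 3 * (s / 4) := by gcongr
    nlinarith
  have h9 : |μ ^ 2 - μ' ^ 2| / 2 * ‖l'‖ ≤ 17 / 64 * ‖y - y'‖ := by
    calc _ ≤ (17 / 16 * s ^ 3 * ‖y - y'‖) / 2 * ‖l'‖ := by gcongr
      _ = (17 / 32 * ‖y - y'‖) * (s ^ 3 * ‖l'‖) := by ring
      _ ≤ (17 / 32 * ‖y - y'‖) * (1 / 2) := by gcongr
      _ = _ := by ring
  have h10 : μ ^ 2 / 2 * ‖l - l'‖ ≤ 289 / 512 * (s ^ 4 * ‖l - l'‖) := by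
    have : μ ^ 2 ≤ (17 / 16 * s ^ 2) ^ 2 := by gcongr
    have h11 : μ ^ 2 / 2 ≤ 289 / 512 * s ^ 4 := by nlinarith
    calc _ ≤ 289 / 512 * s ^ 4 * ‖l - l'‖ := by gcongr
      _ = _ := by ring
  have h12 : 0 ≤ s ^ 4 * ‖l - l'‖ := by positivity
  linarith

end Node

section Geometry

open scoped RealInnerProductSpace

variable {d q : ℕ}

/-- Positions of the leaves: nested, well separated subcubes of the unit cube. -/
def leafPos : (J : ℕ) → TreeLeaf (Fin d → Fin q) J → Fin d → ℝ
  | 0, _ => 0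
  | J + 1, w => fun i => ((w.1 i : ℕ) + leafPos J w.2 i / 2) / q

lemma leafPos_succ (J : ℕ) (c : Fin d → Fin q) (w : TreeLeaf (Fin d → Fin q) J) (i : Fin d) :
    leafPos (J + 1) (c, w) i = ((c i : ℕ) + leafPos J w i / 2) / q := rfl

lemma leafPos_mem (hq : 1 ≤ q) (J : ℕ) (w : TreeLeaf (Fin d → Fin q) J) (i : Fin d) :
    0 ≤ leafPos J w i ∧ leafPos J w i < 1 := by
  induction J with
  | zero => simp [leafPos]
  | succ J ih =>
    obtain ⟨c, w⟩ := w
    have hq0 : (0 : ℝ) < q := by exact_mod_cast hq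
    have hc : ((c i : ℕ) : ℝ) + 1 ≤ q := by exact_mod_cast (c i).2
    obtain ⟨h0, h1⟩ := ih w
    rw [leafPos_succ]
    constructor
    · positivity
    · rw [div_lt_one hq0]; linarith

lemma leafPos_sub_ge (hq : 1 ≤ q) {J : ℕ} {c c' : Fin d → Fin q}
    (w w' : TreeLeaf (Fin d → Fin q) J) {i : Fin d} (hi : c i ≠ c' i) :
    1 / (2 * q : ℝ) ≤ |leafPos (J + 1) (c, w) i - leafPos (J + 1) (c', w') i| := by
  have hq0 : (0 : ℝ) < q := by exact_mod_cast hq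
  obtain ⟨h0, h1⟩ := leafPos_mem hq J w i
  obtain ⟨h0', h1'⟩ := leafPos_mem hq J w' i
  rw [leafPos_succ, leafPos_succ, ← sub_div, abs_div, abs_of_pos hq0, div_le_div_iff₀ (by positivity)
    hq0]
  have h2 : ((c i : ℕ) : ℝ) + 1 ≤ (c' i : ℕ) ∨ ((c' i : ℕ) : ℝ) + 1 ≤ (c i : ℕ) := by
    have : (c i : ℕ) ≠ (c' i : ℕ) := fun h => hi (Fin.ext h)
    rcases lt_or_gt_of_ne this with h | h
    · left; exact_mod_cast h
    · right; exact_mod_cast h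
  have h3 : 1 / 2 ≤ |((c i : ℕ) : ℝ) + leafPos J w i / 2 - ((c' i : ℕ) + leafPos J w' i / 2)| := by
    rw [le_abs]
    rcases h2 with h | h
    · right; linarith
    · left; linarith
  nlinarith

lemma leafPos_separated (hq : 1 ≤ q) (J : ℕ) (w w' : TreeLeaf (Fin d → Fin q) J) (hw : w ≠ w') :
    ∃ i, (1 / (2 * q : ℝ)) ^ J ≤ |leafPos J w i - leafPos J w' i| := by
  have hq0 : (1 : ℝ) ≤ q := by exact_mod_cast hq
  induction J with
  | zero => exact absurd (Subsingleton.elim (α := Unit) w w') hw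
  | succ J ih =>
    obtain ⟨c, w⟩ := w
    obtain ⟨c', w'⟩ := w'
    by_cases hc : c = c'
    · subst hc
      obtain ⟨i, hi⟩ := ih w w' fun h => hw (by rw [h])
      refine ⟨i, ?_⟩
      have h1 : leafPos (J + 1) (c, w) i - leafPos (J + 1) (c, w') i =
          (1 / (2 * q)) * (leafPos J w i - leafPos J w' i) := by
        rw [leafPos_succ, leafPos_succ]; field_simp; ring
      rw [h1, abs_mul, abs_of_nonneg (by positivity), pow_succ']
      gcongr
    · obtain ⟨i, hi⟩ := Function.ne_iff.mp hc
      refine ⟨i, le_trans ?_ (leafPos_sub_ge hq w w' hi)⟩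
      have h1 : 1 / (2 * q : ℝ) ≤ 1 := by
        rw [div_le_one (by positivity)]; linarith
      calc (1 / (2 * q : ℝ)) ^ (J + 1) ≤ (1 / (2 * q : ℝ)) ^ 1 :=
            pow_le_pow_of_le_one (by positivity) h1 (by omega)
        _ = _ := pow_one _

variable {H : Type*} [NormedAddCommGroup H] [InnerProductSpace ℝ H]
variable {A : Fin d → H →L[ℝ] H} {B : H →L[ℝ] H} {η : ℝ}

lemma sum_sub_sq_le_stereographic {s : ℝ} (hs : 0 < s) {y y' : Fin d → ℝ}
    (hy : ∑ i, y i ^ 2 ≤ (s / 4) ^ 2) (hy' : ∑ i, y' i ^ 2 ≤ (s / 4) ^ 2) :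
    ∑ i, (y i - y' i) ^ 2 ≤ s ^ 8 * ∑ i, (2 * y i / (∑ j, y j ^ 2 + s ^ 2) ^ 2 -
      2 * y' i / (∑ j, y' j ^ 2 + s ^ 2) ^ 2) ^ 2 := by
  have hn : ∀ y : Fin d → ℝ, ‖(WithLp.toLp 2 y : EuclideanSpace ℝ (Fin d))‖ ^ 2 = ∑ i, y i ^ 2 :=
    fun y => by rw [EuclideanSpace.norm_sq_eq]; simp
  have hle : ∀ y : Fin d → ℝ, ∑ i, y i ^ 2 ≤ (s / 4) ^ 2 →
      ‖(WithLp.toLp 2 y : EuclideanSpace ℝ (Fin d))‖ ≤ s / 4 := fun y h => by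
    rw [← hn] at h
    exact le_of_sq_le_sq h (by positivity)
  have h1 := norm_sub_le_stereographic hs (hle y hy) (hle y' hy')
  have h2 := pow_le_pow_left₀ (norm_nonneg _) h1 2
  rw [mul_pow, hn, hn, ← WithLp.toLp_smul, ← WithLp.toLp_smul, ← WithLp.toLp_sub,
    ← WithLp.toLp_sub, hn, hn] at h2
  refine h2.trans_eq ?_
  rw [← pow_mul]
  congr 1
  refine Finset.sum_congr rfl fun i _ => ?_
  simp only [Pi.sub_apply, Pi.smul_apply, smul_eq_mul]
  ring

theorem treeData_of_leafVectors [FiniteDimensional ℝ H] (hd : 1 ≤ d) (hq : 1 ≤ q)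
    (hA : ∀ i x y, ⟪A i x, y⟫ = ⟪x, A i y⟫) (hB : ∀ x y, ⟪B x, y⟫ = ⟪x, B y⟫)
    {ρ θ : ℝ} (hρ : 0 < ρ) (hθ : 0 ≤ θ) (hη : 3 * η = θ * ρ ^ 2)
    (hK : ∀ u : Fin d → ℝ, (∀ i, |u i| ≤ 4 * d + 1) → ∀ h, 0 ≤ ⟪h, gapOp A B η u h⟫)
    (J : ℕ) (z : Fin d → ℝ) (σ : ℝ) (hz : ∀ i, 0 ≤ z i) (hσ : 0 < σ) (hz1 : ∀ i, z i + σ ≤ 1)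
    (hρσ : ρ ≤ σ * (1 / (2 * q)) ^ J) (v : TreeLeaf (Fin d → Fin q) J → H)
    (hv : ∀ w, IsLeafVector A B η ρ (z + σ • leafPos J w) (v w)) :
    TreeData (Fin d) (64 * d ^ 3 * (6 * (4 * d + 5)) * q ^ 2 * θ) J v := by
  have hq0 : (1 : ℝ) ≤ q := by exact_mod_cast hq
  have hd0 : (1 : ℝ) ≤ d := by exact_mod_cast hd
  induction J generalizing z σ with
  | zero => trivial
  | succ J ih =>
    have h2q : 1 / (2 * q : ℝ) ≤ 1 := by
      rw [div_le_one (by positivity)]; linarith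
    have hρσ' : ρ ≤ σ := hρσ.trans (mul_le_of_le_one_right hσ.le
      (pow_le_one₀ (by positivity) h2q))
    constructor
    · set s : ℝ := 4 * d * σ with hs
      have hs0 : 0 < s := by positivity
      have hσ1 : σ ≤ 1 := by linarith [hz ⟨0, hd⟩, hz1 ⟨0, hd⟩]
      have hsd : s ≤ 4 * d := by rw [hs]; nlinarith
      have hzabs : ∀ i, |z i| ≤ 1 := fun i => by
        rw [abs_le]; constructor <;> linarith [hz i, hz1 i]
      have hsingle : ∀ (i j : Fin d) (a : ℝ), |(Pi.single i a : Fin d → ℝ) j| ≤ |a| := by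
        intro i j a
        by_cases hij : j = i
        · subst hij; simp
        · simp [hij]
      obtain ⟨X, hX, hXv⟩ := exists_node_operators hA hB (z := z) hs0 hρ
        (hρσ'.trans (by rw [hs]; nlinarith)) hθ hη
        (hK z fun i => (hzabs i).trans (by linarith))
        (fun i => hK _ fun j => (abs_add_le _ _).trans (by
          have := hsingle i j s
          rw [abs_of_pos hs0] at this
          linarith [hzabs j]))
        (fun i => hK _ fun j => (abs_add_le _ _).trans (by
          have := hsingle i j (-s)
          rw [abs_neg, abs_of_pos hs0] at this
          linarith [hzabs j]))
      have hys : ∀ w : TreeLeaf (Fin d → Fin q) (J + 1), ∑ i, (σ • leafPos (J + 1) w : Fin d → ℝ) i ^ 2 ≤ (s / 4) ^ 2 := by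
        intro w
        calc _ ≤ ∑ i : Fin d, σ ^ 2 := by
              refine Finset.sum_le_sum fun i _ => ?_
              obtain ⟨h0, h1⟩ := leafPos_mem hq (J + 1) w i
              rw [Pi.smul_apply, smul_eq_mul, mul_pow]
              exact mul_le_of_le_one_right (sq_nonneg _) (pow_le_one₀ h0 h1.le)
          _ = d * σ ^ 2 := by simp
          _ ≤ (d * d) * σ ^ 2 := by gcongr; nlinarith
          _ = _ := by rw [hs]; ring
      refine ⟨1 / (8 * d * q * s ^ 3), by positivity, X, hX, fun i w =>
        2 * (σ • leafPos (J + 1) w : Fin d → ℝ) i /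
          (∑ j, (σ • leafPos (J + 1) w : Fin d → ℝ) j ^ 2 + s ^ 2) ^ 2, fun w => ?_,
        fun w w' hww => ?_⟩
      · have hpos : ∀ i, 0 ≤ σ * leafPos (J + 1) w i ∧ σ * leafPos (J + 1) w i ≤ σ := fun i => by
          obtain ⟨h0, h1⟩ := leafPos_mem hq (J + 1) w i
          exact ⟨by positivity, by nlinarith⟩
        refine (hXv _ (v w) (hys w) (hv w) (hK _ fun i => ?_) (hK _ fun i => ?_)).trans_eq ?_
        · rw [Pi.add_apply, Pi.smul_apply, smul_eq_mul, abs_le]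
          constructor <;> linarith [hz i, hz1 i, hpos i]
        · rw [Pi.add_apply, Pi.neg_apply, Pi.smul_apply, smul_eq_mul, abs_le]
          constructor <;> linarith [hz i, hz1 i, hpos i]
        · field_simp
          ring
      · obtain ⟨i, hi⟩ := Function.ne_iff.mp hww
        have h1 := sum_sub_sq_le_stereographic hs0 (hys w) (hys w')
        have h2 : (σ * (1 / (2 * q))) ^ 2 ≤ ∑ i, ((σ • leafPos (J + 1) w : Fin d → ℝ) i -
            (σ • leafPos (J + 1) w' : Fin d → ℝ) i) ^ 2 := by
          refine le_trans ?_ (Finset.single_le_sum (f := fun i =>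
            ((σ • leafPos (J + 1) w : Fin d → ℝ) i - (σ • leafPos (J + 1) w' : Fin d → ℝ) i) ^ 2)
            (fun _ _ => sq_nonneg _) (Finset.mem_univ i))
          have h3 := leafPos_sub_ge hq w.2 w'.2 hi
          simp only [Pi.smul_apply, smul_eq_mul]
          rw [← mul_sub, mul_pow, mul_pow, ← sq_abs (leafPos (J + 1) w i - _)]
          gcongr
        have h4 : s ^ 8 * (1 / (8 * d * q * s ^ 3)) ^ 2 = (σ * (1 / (2 * q))) ^ 2 := by
          have : s ^ 8 * (1 / (8 * d * q * s ^ 3)) ^ 2 = (s / (8 * d * q)) ^ 2 := by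
            field_simp
          rw [this, hs]
          congr 1
          field_simp
          norm_num
        rw [← h4] at h2
        exact le_of_mul_le_mul_left (h2.trans h1) (by positivity)
    · intro c
      refine ih (fun i => z i + σ * ((c i : ℕ) / q)) (σ * (1 / (2 * q))) (fun i => ?_)
        (by positivity) (fun i => ?_) ?_ _ fun w => ?_
      · have := hz i
        positivity
      · have hc : ((c i : ℕ) : ℝ) + 1 ≤ q := by exact_mod_cast (c i).2
        have h1 : ((c i : ℕ) : ℝ) / q + 1 / (2 * q) ≤ 1 := by
          rw [div_add_div _ _ (by positivity) (by positivity), div_le_one (by positivity)]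
          nlinarith
        have h2 : σ * ((c i : ℕ) / q + 1 / (2 * q)) ≤ σ * 1 := by gcongr
        linarith [hz1 i]
      · rw [mul_assoc, ← pow_succ']; exact hρσ
      · convert hv (c, w) using 1
        funext i
        simp only [Pi.add_apply, Pi.smul_apply, smul_eq_mul]
        rw [leafPos_succ]
        field_simp
        ring

instance nonemptyTreeLeaf (β : Type) [Nonempty β] : (J : ℕ) → Nonempty (TreeLeaf β J)
  | 0 => inferInstanceAs (Nonempty Unit)
  | J + 1 =>
    have := nonemptyTreeLeaf β J
    inferInstanceAs (Nonempty (β × TreeLeaf β J))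

/-- The polyhedral function supported by the tangent planes of `|u|²` at the leaves. -/
def leafMax (d q J : ℕ) [NeZero q] (u : Fin d → ℝ) : ℝ :=
  Finset.univ.sup' Finset.univ_nonempty fun w : TreeLeaf (Fin d → Fin q) J =>
    2 * ∑ i, leafPos J w i * u i - ∑ i, leafPos J w i ^ 2

lemma leafMax_le_iff [NeZero q] {J : ℕ} {u : Fin d → ℝ} {a : ℝ} :
    leafMax d q J u ≤ a ↔ ∀ w : TreeLeaf (Fin d → Fin q) J,
      ∑ i, u i ^ 2 - ∑ i, (u i - leafPos J w i) ^ 2 ≤ a := by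
  rw [leafMax, Finset.sup'_le_iff]
  refine forall_congr' fun w => ?_
  have : 2 * ∑ i, leafPos J w i * u i - ∑ i, leafPos J w i ^ 2 =
      ∑ i, u i ^ 2 - ∑ i, (u i - leafPos J w i) ^ 2 := by
    rw [Finset.mul_sum, ← Finset.sum_sub_distrib, ← Finset.sum_sub_distrib]
    exact Finset.sum_congr rfl fun i _ => by ring
  rw [this]
  simp

lemma leafMax_le [NeZero q] (J : ℕ) (u : Fin d → ℝ) : leafMax d q J u ≤ ∑ i, u i ^ 2 := by
  rw [leafMax_le_iff]
  intro w
  have : 0 ≤ ∑ i, (u i - leafPos J w i) ^ 2 := Finset.sum_nonneg fun _ _ => sq_nonneg _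
  linarith

lemma le_leafMax [NeZero q] (J : ℕ) (w : TreeLeaf (Fin d → Fin q) J) :
    ∑ i, leafPos J w i ^ 2 ≤ leafMax d q J (leafPos J w) := by
  have := leafMax_le_iff.mp (le_refl (leafMax d q J (leafPos J w))) w
  simpa using this

lemma sq_le_sum_sq_of_le_abs {ι : Type*} [Fintype ι] {p : ι → ℝ} {j : ι} {ρ : ℝ} (hρ : 0 ≤ ρ)
    (h : ρ ≤ |p j|) : ρ ^ 2 ≤ ∑ i, p i ^ 2 := by
  refine le_trans ?_ (Finset.single_le_sum (f := fun i => p i ^ 2) (fun _ _ => sq_nonneg _)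
    (Finset.mem_univ j))
  rw [← sq_abs (p j)]
  gcongr

lemma leafMax_add_single_le [NeZero q] (J : ℕ) (w : TreeLeaf (Fin d → Fin q) J) (i : Fin d)
    {ρ a : ℝ} (hρ0 : 0 ≤ ρ) (hρ : 2 * ρ ≤ (1 / (2 * q : ℝ)) ^ J) (ha : |a| = ρ) :
    leafMax d q J (leafPos J w + Pi.single i a) ≤
      ∑ j, (leafPos J w + Pi.single i a : Fin d → ℝ) j ^ 2 - ρ ^ 2 := by
  rw [leafMax_le_iff]
  intro w'
  have key : ∃ j, ρ ≤ |(leafPos J w + Pi.single i a : Fin d → ℝ) j - leafPos J w' j| := by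
    by_cases hw : w = w'
    · subst hw
      exact ⟨i, by simp [ha]⟩
    · obtain ⟨j, hj⟩ := leafPos_separated (NeZero.one_le) J w w' hw
      refine ⟨j, ?_⟩
      have h1 : |(Pi.single i a : Fin d → ℝ) j| ≤ ρ := by
        by_cases hij : j = i
        · subst hij; simp [ha]
        · simp [hij, hρ0]
      have h2 := abs_sub_le (leafPos J w j) ((leafPos J w + Pi.single i a : Fin d → ℝ) j)
        (leafPos J w' j)
      have h3 : |leafPos J w j - (leafPos J w + Pi.single i a : Fin d → ℝ) j| =
          |(Pi.single i a : Fin d → ℝ) j| := by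
        rw [Pi.add_apply, sub_add_cancel_left, abs_neg]
      linarith
  obtain ⟨j, hj⟩ := key
  have h3 := sq_le_sum_sq_of_le_abs (p := fun j =>
    (leafPos J w + Pi.single i a : Fin d → ℝ) j - leafPos J w' j) hρ0 hj
  linarith

/-- Operators representing `leafMax` up to a small error need large dimension. -/
theorem pow_le_finrank_of_approx [FiniteDimensional ℝ H] (hd : 1 ≤ d) [NeZero q] (J : ℕ)
    (hA : ∀ i x y, ⟪A i x, y⟫ = ⟪x, A i y⟫) (hB : ∀ x y, ⟪B x, y⟫ = ⟪x, B y⟫) (hη : 0 ≤ η)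
    (hupper : ∀ u : Fin d → ℝ, (∀ i, |u i| ≤ 4 * d + 1) → ∀ h,
      ⟪h, ∑ i, u i • A i h + B h⟫ ≤ (leafMax d q J u + η) * ‖h‖ ^ 2)
    (hlower : ∀ u : Fin d → ℝ, (∀ i, |u i| ≤ 4 * d + 1) →
      ∃ v, ‖v‖ = 1 ∧ leafMax d q J u - 2 * η ≤ ⟪v, ∑ i, u i • A i v + B v⟫)
    (hsmall : 32 * (q : ℝ) ^ d *
      (64 * d ^ 3 * (6 * (4 * d + 5)) * q ^ 2 * (12 * η * (2 * q) ^ (2 * J))) * 2 ^ J ≤ 1) :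
    ((q : ℝ) ^ d) ^ J ≤ 2 ^ (J + 2) * Module.finrank ℝ H := by
  have hq : 1 ≤ q := NeZero.one_le
  have hq0 : (1 : ℝ) ≤ q := by exact_mod_cast hq
  have hd0 : (1 : ℝ) ≤ d := by exact_mod_cast hd
  set ρ : ℝ := (1 / (2 * q : ℝ)) ^ J / 2 with hρ
  have hρ0 : 0 < ρ := by positivity
  have hρ1 : ρ ≤ 1 / 2 := by
    rw [hρ]
    gcongr
    refine pow_le_one₀ (by positivity) ?_
    rw [div_le_one (by positivity)]; linarith
  set θ : ℝ := 12 * η * (2 * q) ^ (2 * J) with hθ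
  have hθη : 3 * η = θ * ρ ^ 2 := by
    rw [hθ, hρ, pow_mul', div_pow, one_div, inv_pow]
    field_simp
    ring
  have hgap : ∀ u h, ⟪h, gapOp A B η u h⟫ =
      (∑ i, u i ^ 2 + η) * ‖h‖ ^ 2 - ⟪h, ∑ i, u i • A i h + B h⟫ := by
    intro u h
    rw [gapOp_apply, sub_sub, inner_sub_right, real_inner_smul_right, real_inner_self_eq_norm_sq]
  have hpos : ∀ w i, |leafPos (d := d) (q := q) J w i| ≤ 1 := fun w i => by
    obtain ⟨h0, h1⟩ := leafPos_mem hq J w i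
    rw [abs_of_nonneg h0]; exact h1.le
  have hK : ∀ u : Fin d → ℝ, (∀ i, |u i| ≤ 4 * d + 1) → ∀ h, 0 ≤ ⟪h, gapOp A B η u h⟫ := by
    intro u hu h
    rw [hgap]
    have h1 := hupper u hu h
    have h2 : (leafMax d q J u + η) * ‖h‖ ^ 2 ≤ (∑ i, u i ^ 2 + η) * ‖h‖ ^ 2 := by
      gcongr; exact leafMax_le J u
    linarith
  have hside : ∀ (w : TreeLeaf (Fin d → Fin q) J) (a : ℝ), |a| = ρ → ∀ i h,
      ρ ^ 2 * ‖h‖ ^ 2 ≤ ⟪h, gapOp A B η (leafPos J w + Pi.single i a) h⟫ := by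
    intro w a ha i h
    rw [hgap]
    have h1 := hupper (leafPos J w + Pi.single i a) (fun j => ?_) h
    · have h2 := leafMax_add_single_le J w i hρ0.le (by rw [hρ]; linarith) ha
      have h3 : (leafMax d q J (leafPos J w + Pi.single i a) + η) * ‖h‖ ^ 2 ≤
          (∑ j, (leafPos J w + Pi.single i a : Fin d → ℝ) j ^ 2 - ρ ^ 2 + η) * ‖h‖ ^ 2 := by gcongr
      linarith
    · rw [Pi.add_apply]
      refine (abs_add_le _ _).trans ?_
      have h4 : |(Pi.single i a : Fin d → ℝ) j| ≤ ρ := by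
        by_cases hij : j = i
        · subst hij; simp [ha]
        · simp [hij, hρ0.le]
      linarith [hpos w j]
  choose v hv1 hv2 using fun w : TreeLeaf (Fin d → Fin q) J =>
    hlower (leafPos J w) fun i => (hpos w i).trans (by linarith)
  have hleaf : ∀ w, IsLeafVector A B η ρ (0 + (1 : ℝ) • leafPos J w) (v w) := by
    intro w
    rw [zero_add, one_smul]
    refine ⟨hv1 w, ?_, fun i h => hside w ρ (abs_of_pos hρ0) i h,
      fun i h => hside w (-ρ) (by rw [abs_neg, abs_of_pos hρ0]) i h⟩
    rw [hgap, hv1 w]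
    have h1 := hv2 w
    have h2 := le_leafMax J w
    linarith
  have hT := treeData_of_leafVectors hd hq hA hB hρ0 (by positivity) hθη hK J 0 1
    (fun _ => le_rfl) one_pos (fun _ => by simp) (by rw [hρ, one_mul]; linarith [hρ0]) v hleaf
  have hcard : (Fintype.card (Fin d → Fin q) : ℝ) = (q : ℝ) ^ d := by simp
  have := hT.card_le (by positivity) hv1 (by rw [hcard]; exact hsmall)
  rwa [hcard] at this

end Geometry

section LambdaMax

variable {m : ℕ}

lemma abs_rayleigh_le (A : Matrix (Fin m) (Fin m) ℝ) {v : Fin m → ℝ} (hv : ∑ i, v i ^ 2 = 1) :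
    |rayleigh A v| ≤ ∑ i, ∑ j, |A i j| := by
  have h1 : ∀ i, |v i| ≤ 1 := fun i => by
    rw [← sq_le_one_iff_abs_le_one, ← hv]
    exact Finset.single_le_sum (f := fun i => v i ^ 2) (fun _ _ => sq_nonneg _) (Finset.mem_univ i)
  refine (Finset.abs_sum_le_sum_abs _ _).trans (Finset.sum_le_sum fun i _ => ?_)
  refine (Finset.abs_sum_le_sum_abs _ _).trans (Finset.sum_le_sum fun j _ => ?_)
  rw [abs_mul, abs_mul]
  calc |v i| * |A i j| * |v j| ≤ 1 * |A i j| * 1 := by gcongr <;> exact h1 _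
    _ = |A i j| := by ring

lemma rayleigh_le_lambdaMax (A : Matrix (Fin m) (Fin m) ℝ) {v : Fin m → ℝ}
    (hv : ∑ i, v i ^ 2 = 1) : rayleigh A v ≤ lambdaMax A := by
  refine le_csSup ⟨∑ i, ∑ j, |A i j|, ?_⟩ ⟨v, hv, rfl⟩
  rintro _ ⟨w, hw, rfl⟩
  exact (le_abs_self _).trans (abs_rayleigh_le A hw)

lemma rayleigh_smul (A : Matrix (Fin m) (Fin m) ℝ) (a : ℝ) (v : Fin m → ℝ) :
    rayleigh A (a • v) = a ^ 2 * rayleigh A v := by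
  simp only [rayleigh, Finset.mul_sum, Pi.smul_apply, smul_eq_mul]
  exact Finset.sum_congr rfl fun i _ => Finset.sum_congr rfl fun j _ => by ring

lemma rayleigh_le_lambdaMax_mul (A : Matrix (Fin m) (Fin m) ℝ) (v : Fin m → ℝ) :
    rayleigh A v ≤ lambdaMax A * ∑ i, v i ^ 2 := by
  rcases (Finset.sum_nonneg fun i _ => sq_nonneg (v i) :
    0 ≤ ∑ i, v i ^ 2).eq_or_lt with h | h
  · have hv : ∀ i, v i = 0 := fun i => by
      have := (Finset.sum_eq_zero_iff_of_nonneg fun i _ => sq_nonneg (v i)).mp h.symm i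
        (Finset.mem_univ i)
      exact pow_eq_zero_iff (two_ne_zero) |>.mp this
    rw [← h]
    simp [rayleigh, hv]
  · set S := ∑ i, v i ^ 2 with hS
    have h1 : ((√S)⁻¹) ^ 2 = S⁻¹ := by rw [inv_pow, Real.sq_sqrt h.le]
    have h2 := rayleigh_le_lambdaMax A (v := (√S)⁻¹ • v) (by
      simp only [Pi.smul_apply, smul_eq_mul, mul_pow, h1]
      rw [← Finset.mul_sum, ← hS, inv_mul_cancel₀ h.ne'])
    rw [rayleigh_smul, h1, inv_mul_le_iff₀ h] at h2
    linarith

lemma nonempty_rayleigh (hm : 1 ≤ m) (A : Matrix (Fin m) (Fin m) ℝ) :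
    {r : ℝ | ∃ v : Fin m → ℝ, (∑ i, v i ^ 2) = 1 ∧ r = rayleigh A v}.Nonempty :=
  ⟨_, Pi.single ⟨0, hm⟩ 1, by simp [Pi.single_apply], rfl⟩

lemma exists_lambdaMax_sub_lt (hm : 1 ≤ m) (A : Matrix (Fin m) (Fin m) ℝ) {η : ℝ} (hη : 0 < η) :
    ∃ v : Fin m → ℝ, ∑ i, v i ^ 2 = 1 ∧ lambdaMax A - η < rayleigh A v := by
  obtain ⟨_, ⟨v, hv, rfl⟩, h⟩ := exists_lt_of_lt_csSup (nonempty_rayleigh hm A)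
    (show lambdaMax A - η < lambdaMax A by linarith)
  exact ⟨v, hv, h⟩

lemma abs_lambdaMax_le (hm : 1 ≤ m) (A : Matrix (Fin m) (Fin m) ℝ) :
    |lambdaMax A| ≤ ∑ i, ∑ j, |A i j| := by
  obtain ⟨_, v, hv, rfl⟩ := nonempty_rayleigh hm A
  rw [abs_le]
  constructor
  · linarith [rayleigh_le_lambdaMax A hv, (abs_le.mp (abs_rayleigh_le A hv)).1]
  · refine csSup_le (nonempty_rayleigh hm A) ?_
    rintro _ ⟨w, hw, rfl⟩
    exact (le_abs_self _).trans (abs_rayleigh_le A hw)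

lemma lambdaMax_smul_one (hm : 1 ≤ m) (b : ℝ) :
    lambdaMax (b • (1 : Matrix (Fin m) (Fin m) ℝ)) = b := by
  have h : ∀ v : Fin m → ℝ, rayleigh (b • (1 : Matrix (Fin m) (Fin m) ℝ)) v =
      b * ∑ i, v i ^ 2 := fun v => by
    simp only [rayleigh, Matrix.smul_apply, Matrix.one_apply, Finset.mul_sum, smul_eq_mul]
    refine Finset.sum_congr rfl fun i _ => ?_
    simp
    ring
  have h1 : {r : ℝ | ∃ v : Fin m → ℝ, (∑ i, v i ^ 2) = 1 ∧
      r = rayleigh (b • (1 : Matrix (Fin m) (Fin m) ℝ)) v} = {b} := by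
    ext r
    constructor
    · rintro ⟨v, hv, rfl⟩
      rw [h, hv, mul_one]; rfl
    · rintro rfl
      obtain ⟨_, v, hv, -⟩ := nonempty_rayleigh hm (1 : Matrix (Fin m) (Fin m) ℝ)
      exact ⟨v, hv, by rw [h, hv, mul_one]⟩
  rw [lambdaMax, h1, csSup_singleton]

open scoped RealInnerProductSpace

lemma inner_toEuclideanCLM (A : Matrix (Fin m) (Fin m) ℝ) (v : EuclideanSpace ℝ (Fin m)) :
    ⟪v, Matrix.toEuclideanCLM (𝕜 := ℝ) A v⟫ = rayleigh A v := by
  rw [rayleigh, PiLp.inner_apply]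
  refine Finset.sum_congr rfl fun i _ => ?_
  simp [Matrix.ofLp_toEuclideanCLM, Matrix.mulVec, dotProduct, Finset.sum_mul]
  refine Finset.sum_congr rfl fun j _ => by ring

lemma inner_toEuclideanCLM_comm {A : Matrix (Fin m) (Fin m) ℝ} (hA : A.IsSymm)
    (v w : EuclideanSpace ℝ (Fin m)) :
    ⟪Matrix.toEuclideanCLM (𝕜 := ℝ) A v, w⟫ = ⟪v, Matrix.toEuclideanCLM (𝕜 := ℝ) A w⟫ := by
  simp only [PiLp.inner_apply, Matrix.ofLp_toEuclideanCLM, Matrix.mulVec, dotProduct]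
  simp only [RCLike.inner_apply, conj_trivial, Finset.sum_mul, Finset.mul_sum]
  rw [Finset.sum_comm]
  refine Finset.sum_congr rfl fun j _ => Finset.sum_congr rfl fun i _ => ?_
  rw [hA.apply]
  ring

variable {d : ℕ}

/-- A pencil whose largest eigenvalue approximates `leafMax` well has large size. -/
theorem pow_le_of_lambdaMax_approx {q : ℕ} [NeZero q] (hd : 1 ≤ d) (hm : 1 ≤ m) (J : ℕ)
    {A : Fin d → Matrix (Fin m) (Fin m) ℝ} {B : Matrix (Fin m) (Fin m) ℝ}
    (hA : ∀ i, (A i).IsSymm) (hB : B.IsSymm) (x₀ : Fin d → ℝ) (r α : ℝ) {η : ℝ}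
    (hα : 0 < α) (hη : 0 < η)
    (happrox : ∀ u : Fin d → ℝ, (∀ i, |u i| ≤ 4 * d + 1) →
      |lambdaMax (pencil A (x₀ + r • u) + B) - α * leafMax d q J u| ≤ α * η)
    (hsmall : 32 * (q : ℝ) ^ d *
      (64 * d ^ 3 * (6 * (4 * d + 5)) * q ^ 2 * (12 * η * (2 * q) ^ (2 * J))) * 2 ^ J ≤ 1) :
    ((q : ℝ) ^ d) ^ J ≤ 2 ^ (J + 2) * m := by
  set T := Matrix.toEuclideanCLM (𝕜 := ℝ) (n := Fin m) with hT
  have hsymm : ∀ x, (pencil A x + B).IsSymm := fun x => by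
    refine Matrix.IsSymm.add ?_ hB
    rw [Matrix.IsSymm, pencil, Matrix.transpose_sum]
    exact Finset.sum_congr rfl fun i _ => by rw [Matrix.transpose_smul, (hA i).eq]
  have hform : ∀ (u : Fin d → ℝ) (h : EuclideanSpace ℝ (Fin m)),
      ⟪h, ∑ i, u i • ((α⁻¹ * r) • T (A i)) h + (α⁻¹ • T (pencil A x₀ + B)) h⟫ =
        α⁻¹ * rayleigh (pencil A (x₀ + r • u) + B) h := by
    intro u h
    rw [← inner_toEuclideanCLM, ← real_inner_smul_right]
    congr 1
    have : pencil A (x₀ + r • u) + B = r • ∑ i, u i • A i + (pencil A x₀ + B) := by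
      simp only [pencil, Pi.add_apply, Pi.smul_apply, smul_eq_mul, add_smul, mul_smul,
        Finset.sum_add_distrib, Finset.smul_sum]
      abel
    rw [this, ← hT, map_add T (r • ∑ i, u i • A i), map_smul, map_sum]
    simp only [map_smul, _root_.add_apply, _root_.smul_apply,
      _root_.sum_apply, smul_add, Finset.smul_sum]
    congr 1
    refine Finset.sum_congr rfl fun i _ => ?_
    simp only [smul_smul]
    congr 1
    ring
  have := pow_le_finrank_of_approx (q := q) (H := EuclideanSpace ℝ (Fin m))
    (A := fun i => (α⁻¹ * r) • T (A i)) (B := α⁻¹ • T (pencil A x₀ + B)) hd J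
    (fun i x y => ?_) (fun x y => ?_) hη.le (fun u hu h => ?_) (fun u hu => ?_) hsmall
  · simpa using this
  · rw [_root_.smul_apply, _root_.smul_apply, real_inner_smul_left,
      real_inner_smul_right, inner_toEuclideanCLM_comm (hA i)]
  · rw [_root_.smul_apply, _root_.smul_apply, real_inner_smul_left,
      real_inner_smul_right, inner_toEuclideanCLM_comm (hsymm x₀)]
  · rw [hform, inv_mul_le_iff₀ hα, EuclideanSpace.real_norm_sq_eq, ← mul_assoc]
    refine (rayleigh_le_lambdaMax_mul _ _).trans ?_
    have h1 := (abs_le.mp (happrox u hu)).2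
    gcongr
    linarith
  · obtain ⟨v, hv, hv2⟩ := exists_lambdaMax_sub_lt hm (pencil A (x₀ + r • u) + B)
      (mul_pos hα hη)
    refine ⟨WithLp.toLp 2 v, ?_, ?_⟩
    · rw [EuclideanSpace.norm_eq]; simp [hv]
    · rw [hform, le_inv_mul_iff₀ hα]
      have h1 := (abs_le.mp (happrox u hu)).1
      have : (WithLp.toLp 2 v : EuclideanSpace ℝ (Fin m)).ofLp = v := rfl
      rw [this]
      linarith

end LambdaMax

section HardFunction

variable {d : ℕ}

lemma leafMax_sub_le {q : ℕ} [NeZero q] (J : ℕ) (u u' : Fin d → ℝ) :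
    leafMax d q J u - leafMax d q J u' ≤ 2 * d * √(∑ i, (u i - u' i) ^ 2) := by
  rw [sub_le_iff_le_add']
  refine Finset.sup'_le _ _ fun w _ => ?_
  have h1 : 2 * ∑ i, leafPos J w i * u' i - ∑ i, leafPos J w i ^ 2 ≤ leafMax d q J u' :=
    Finset.le_sup' (fun w : TreeLeaf (Fin d → Fin q) J =>
      2 * ∑ i, leafPos J w i * u' i - ∑ i, leafPos J w i ^ 2) (Finset.mem_univ w)
  have h2 : ∑ i, leafPos J w i * u i - ∑ i, leafPos J w i * u' i ≤
      d * √(∑ i, (u i - u' i) ^ 2) := by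
    rw [← Finset.sum_sub_distrib]
    calc _ ≤ ∑ i : Fin d, √(∑ i, (u i - u' i) ^ 2) := ?_
      _ = _ := by simp
    refine Finset.sum_le_sum fun i _ => ?_
    obtain ⟨h0, h1⟩ := leafPos_mem (d := d) (q := q) NeZero.one_le J w i
    have h3 : |u i - u' i| ≤ √(∑ i, (u i - u' i) ^ 2) := by
      refine Real.abs_le_sqrt ?_
      exact Finset.single_le_sum (f := fun i => (u i - u' i) ^ 2) (fun _ _ => sq_nonneg _)
        (Finset.mem_univ i)
    rw [← mul_sub]
    calc _ ≤ |leafPos J w i * (u i - u' i)| := le_abs_self _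
      _ = leafPos J w i * |u i - u' i| := by rw [abs_mul, abs_of_nonneg h0]
      _ ≤ 1 * |u i - u' i| := by gcongr
      _ ≤ _ := by rwa [one_mul]
  linarith

lemma abs_leafMax_sub_le {q : ℕ} [NeZero q] (J : ℕ) (u u' : Fin d → ℝ) :
    |leafMax d q J u - leafMax d q J u'| ≤ 2 * d * √(∑ i, (u i - u' i) ^ 2) := by
  have h1 := leafMax_sub_le (q := q) J u' u
  have h2 : ∑ i, (u' i - u i) ^ 2 = ∑ i, (u i - u' i) ^ 2 :=
    Finset.sum_congr rfl fun i _ => by ring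
  rw [h2] at h1
  rw [abs_le]
  constructor
  · linarith
  · exact leafMax_sub_le J u u'

lemma convexOn_leafMax {q : ℕ} [NeZero q] (J : ℕ) :
    ConvexOn ℝ Set.univ (leafMax d q J) := by
  refine ⟨convex_univ, fun u _ u' _ a b ha hb hab => ?_⟩
  refine Finset.sup'_le _ _ fun w _ => ?_
  have h : ∀ u : Fin d → ℝ, 2 * ∑ i, leafPos J w i * u i - ∑ i, leafPos J w i ^ 2 ≤
      leafMax d q J u := fun u => Finset.le_sup' (fun w : TreeLeaf (Fin d → Fin q) J =>
      2 * ∑ i, leafPos J w i * u i - ∑ i, leafPos J w i ^ 2) (Finset.mem_univ w)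
  have h1 : 2 * ∑ i, leafPos J w i * (a • u + b • u') i - ∑ i, leafPos J w i ^ 2 =
      a * (2 * ∑ i, leafPos J w i * u i - ∑ i, leafPos J w i ^ 2) +
      b * (2 * ∑ i, leafPos J w i * u' i - ∑ i, leafPos J w i ^ 2) := by
    have h2 : ∑ i, leafPos J w i * (a • u + b • u') i =
        a * ∑ i, leafPos J w i * u i + b * ∑ i, leafPos J w i * u' i := by
      rw [Finset.mul_sum, Finset.mul_sum, ← Finset.sum_add_distrib]
      refine Finset.sum_congr rfl fun i _ => ?_
      simp only [Pi.add_apply, Pi.smul_apply, smul_eq_mul]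
      ring
    rw [h2]
    obtain rfl : b = 1 - a := by linarith
    ring
  rw [h1, smul_eq_mul, smul_eq_mul]
  gcongr <;> exact h _

/-- With suitable branching and depth, `leafMax` resists approximation by every `m × m` pencil. -/
theorem exists_leafMax_resisting (hd : 1 ≤ d) {ε : ℝ} (hε : 0 < ε) :
    ∃ c : ℝ, 0 < c ∧ ∃ J : ℕ, ∀ m : ℕ, 1 ≤ m → ∃ (q : ℕ) (_ : NeZero q),
      ∀ (A : Fin d → Matrix (Fin m) (Fin m) ℝ) (B : Matrix (Fin m) (Fin m) ℝ),
        (∀ i, (A i).IsSymm) → B.IsSymm → ∀ (x₀ : Fin d → ℝ) (r α : ℝ), 0 < α →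
          ∃ u : Fin d → ℝ, (∀ i, |u i| ≤ 4 * d + 1) ∧ α * (c * (m : ℝ) ^ (-(2 / d + ε))) <
            |lambdaMax (pencil A (x₀ + r • u) + B) - α * leafMax d q J u| := by
  have hd0 : (0 : ℝ) < d := by exact_mod_cast hd
  obtain ⟨J, hJ⟩ := exists_nat_gt ((d + 2) / (d * ε) : ℝ)
  have hJ0 : (0 : ℝ) < J := lt_of_le_of_lt (by positivity) hJ
  have hJε : ((d + 2 + 2 * J : ℕ) : ℝ) / (d * J) ≤ 2 / d + ε := by
    rw [div_lt_iff₀ (by positivity)] at hJ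
    rw [div_le_iff₀ (by positivity)]
    push_cast
    have : (2 / d + ε) * (d * J : ℝ) = 2 * J + J * (d * ε) := by field_simp
    linarith
  set D : ℝ := 32 * (64 * d ^ 3 * (6 * (4 * d + 5)) * (12 * 2 ^ (2 * J))) * 2 ^ J with hD
  have hD0 : 0 < D := by positivity
  set n := d + 2 + 2 * J with hn
  set a : ℝ := (2 ^ (J + 3)) ^ (1 / (d * J : ℝ)) with ha
  have ha0 : 0 < a := by positivity
  refine ⟨1 / (D * (2 * a) ^ n), by positivity, J, fun m hm => ?_⟩
  have hm0 : (1 : ℝ) ≤ m := by exact_mod_cast hm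
  set b : ℝ := (2 ^ (J + 3) * (m : ℝ)) ^ (1 / (d * J : ℝ)) with hb
  have hbase : (1 : ℝ) ≤ 2 ^ (J + 3) * m :=
    one_le_mul_of_one_le_of_one_le (one_le_pow₀ (by norm_num)) hm0
  have hb1 : 1 ≤ b := Real.one_le_rpow hbase (by positivity)
  have hbm : b = a * (m : ℝ) ^ (1 / (d * J : ℝ)) := Real.mul_rpow (by positivity) (by positivity)
  set q := ⌈b⌉₊ with hq
  have hbq : b ≤ q := Nat.le_ceil b
  have hq1 : (1 : ℝ) ≤ q := hb1.trans hbq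
  have hq2 : (q : ℝ) ≤ 2 * b := by
    have := Nat.ceil_lt_add_one (zero_le_one.trans hb1)
    linarith
  have hq0 : NeZero q := ⟨by rintro h; rw [h] at hq1; norm_num at hq1⟩
  refine ⟨q, hq0, fun A B hA hB x₀ r α hα => ?_⟩
  by_contra! hcon
  set η : ℝ := 1 / (D * q ^ n) with hη
  have hη0 : 0 < η := by positivity
  have hle : 1 / (D * (2 * a) ^ n) * (m : ℝ) ^ (-(2 / d + ε)) ≤ η := by
    have h1 : (q : ℝ) ^ n ≤ (2 * a) ^ n * (m : ℝ) ^ (2 / d + ε) := by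
      calc (q : ℝ) ^ n ≤ (2 * b) ^ n := by gcongr
        _ = (2 * a) ^ n * (m : ℝ) ^ ((n : ℝ) / (d * J)) := by
            rw [hbm, ← mul_assoc, mul_pow, ← Real.rpow_natCast ((m : ℝ) ^ _) n,
              ← Real.rpow_mul (by positivity)]
            congr 2
            ring
        _ ≤ _ := by gcongr
    rw [Real.rpow_neg (by positivity), hη, ← div_eq_mul_inv, div_div]
    refine one_div_le_one_div_of_le (by positivity) ?_
    exact (mul_le_mul_of_nonneg_left h1 hD0.le).trans_eq (mul_assoc _ _ _).symm
  have hfin := pow_le_of_lambdaMax_approx (q := q) hd hm J hA hB x₀ r α hα hη0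
    (fun u hu => (hcon u hu).trans (by gcongr)) (by
      refine le_of_eq ?_
      rw [hη, hD, hn, mul_pow, pow_add, pow_add]
      field_simp)
  have h1 : b ^ (d * J) = 2 ^ (J + 3) * (m : ℝ) := by
    rw [hb, ← Real.rpow_natCast, ← Real.rpow_mul (by positivity)]
    push_cast
    rw [one_div_mul_cancel (by positivity), Real.rpow_one]
  have h2 : b ^ (d * J) ≤ ((q : ℝ) ^ d) ^ J := by
    rw [← pow_mul]; gcongr
  have h3 : (2 : ℝ) ^ (J + 3) = 2 * 2 ^ (J + 2) := by ring
  have h4 : (0 : ℝ) < 2 ^ (J + 2) * m := by positivity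
  rw [h1, h3] at h2
  linarith

/-- Lipschitz convex functions which no spectrahedral function of size `m` approximates well. -/
theorem exists_hard_function (hd : 1 ≤ d) {L : ℝ} (hL : 0 < L) {Ω : Set (Fin d → ℝ)}
    (hΩconv : Convex ℝ Ω) (hΩfull : (interior Ω).Nonempty) {ε : ℝ} (hε : 0 < ε) :
    ∃ c : ℝ, 0 < c ∧ ∀ m : ℕ, 1 ≤ m → ∃ fstar : (Fin d → ℝ) → ℝ, ConvexOn ℝ Ω fstar ∧
      (∀ x ∈ Ω, ∀ y ∈ Ω, |fstar x - fstar y| ≤ L * √(∑ i, (x i - y i) ^ 2)) ∧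
      ∀ k : ℝ, ∀ f ∈ SpecFuns m k d, ∃ x ∈ Ω,
        c * (m : ℝ) ^ (-(2 / d + ε)) ≤ |f x - fstar x| := by
  have hd0 : (0 : ℝ) < d := by exact_mod_cast hd
  obtain ⟨c, hc, J, hcJ⟩ := exists_leafMax_resisting hd hε
  obtain ⟨x₀, hx₀⟩ := hΩfull
  obtain ⟨R, hR, hball⟩ := Metric.isOpen_iff.mp isOpen_interior x₀ hx₀
  set r : ℝ := R / (2 * (4 * d + 1)) with hr
  have hr0 : 0 < r := by positivity
  set α : ℝ := L * r / (2 * d) with hα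
  have hα0 : 0 < α := by positivity
  refine ⟨α * c, by positivity, fun m hm => ?_⟩
  obtain ⟨q, hq, hres⟩ := hcJ m hm
  refine ⟨fun x => α * leafMax d q J (r⁻¹ • (x - x₀)), ?_, fun x _ y _ => ?_, fun k f hf => ?_⟩
  · refine ⟨hΩconv, fun x _ y _ a b ha hb hab => ?_⟩
    have h1 := (convexOn_leafMax (d := d) (q := q) J).2 (Set.mem_univ (r⁻¹ • (x - x₀)))
      (Set.mem_univ (r⁻¹ • (y - x₀))) ha hb hab
    have h2 : r⁻¹ • (a • x + b • y - x₀) = a • (r⁻¹ • (x - x₀)) + b • (r⁻¹ • (y - x₀)) := by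
      obtain rfl : b = 1 - a := by linarith
      module
    simp only [h2, smul_eq_mul] at h1 ⊢
    calc _ ≤ α * _ := mul_le_mul_of_nonneg_left h1 hα0.le
      _ = _ := by ring
  · rw [← mul_sub, abs_mul, abs_of_pos hα0]
    have h1 := abs_leafMax_sub_le (q := q) J (r⁻¹ • (x - x₀)) (r⁻¹ • (y - x₀))
    have h2 : ∑ i, ((r⁻¹ • (x - x₀)) i - (r⁻¹ • (y - x₀)) i) ^ 2 =
        (r⁻¹) ^ 2 * ∑ i, (x i - y i) ^ 2 := by
      rw [Finset.mul_sum]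
      refine Finset.sum_congr rfl fun i _ => ?_
      simp only [Pi.smul_apply, Pi.sub_apply, smul_eq_mul]
      ring
    rw [h2, Real.sqrt_mul (sq_nonneg _), Real.sqrt_sq (by positivity)] at h1
    calc _ ≤ α * _ := mul_le_mul_of_nonneg_left h1 hα0.le
      _ = _ := by rw [hα]; field_simp
  · obtain ⟨A, B, hA, hB, hf⟩ := hf
    obtain ⟨u, hu, h⟩ := hres A B (fun i => (hA i).1) hB.1 x₀ r α hα0
    refine ⟨x₀ + r • u, interior_subset (hball ?_), ?_⟩
    · rw [Metric.mem_ball, dist_self_add_left, norm_smul, Real.norm_of_nonneg hr0.le]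
      have h1 : ‖u‖ ≤ 4 * d + 1 := (pi_norm_le_iff_of_nonneg (by positivity)).mpr hu
      calc r * ‖u‖ ≤ r * (4 * d + 1) := by gcongr
        _ = R / 2 := by rw [hr]; field_simp
        _ < R := by linarith
    · have h1 : r⁻¹ • (x₀ + r • u - x₀) = u := by
        rw [add_sub_cancel_left, inv_smul_smul₀ hr0.ne']
      simp only [hf, h1, mul_assoc]
      exact h.le

end HardFunction

section SpectrahedralApproximation

lemma const_mem_specFuns {m : ℕ} (hm : 1 ≤ m) (k : ℝ) (d : ℕ) (b : ℝ) :
    (fun _ => b) ∈ SpecFuns m k d := by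
  refine ⟨fun _ => 0, b • 1, fun _ => ⟨Matrix.isSymm_zero, fun _ _ _ => rfl⟩,
    ⟨Matrix.isSymm_one.smul b, fun i j hij => ?_⟩, fun x => ?_⟩
  · have : i ≠ j := by rintro rfl; exact hij rfl
    simp [this]
  · simp [pencil, lambdaMax_smul_one hm]

lemma bounded_of_mem_specFuns {m d : ℕ} (hm : 1 ≤ m) {k : ℝ} {f : (Fin d → ℝ) → ℝ}
    (hf : f ∈ SpecFuns m k d) {Ω : Set (Fin d → ℝ)} (hΩ : IsCompact Ω) :
    ∃ C, ∀ x ∈ Ω, |f x| ≤ C := by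
  obtain ⟨A, B, -, -, hf⟩ := hf
  obtain ⟨C, hC⟩ := hΩ.exists_bound_of_continuousOn
    (f := fun x => ∑ i, ∑ j, |(pencil A x + B) i j|) (Continuous.continuousOn (by
      simp only [pencil, Matrix.add_apply, Matrix.sum_apply, Matrix.smul_apply]
      fun_prop))
  refine ⟨C, fun x hx => ?_⟩
  rw [hf]
  exact (abs_lambdaMax_le hm _).trans ((le_abs_self _).trans (hC x hx))

lemma exists_sqrt_sum_sq_le {d : ℕ} {Ω : Set (Fin d → ℝ)} (hΩ : IsCompact Ω) (x₀ : Fin d → ℝ) :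
    ∃ R, ∀ x ∈ Ω, √(∑ i, (x i - x₀ i) ^ 2) ≤ R := by
  obtain ⟨R, hR⟩ := hΩ.exists_bound_of_continuousOn (f := fun x => √(∑ i, (x i - x₀ i) ^ 2))
    (Continuous.continuousOn (by fun_prop))
  exact ⟨R, fun x hx => (le_abs_self _).trans (hR x hx)⟩

lemma exists_abs_sub_le {m d : ℕ} (hm : 1 ≤ m) {k : ℝ} {f : (Fin d → ℝ) → ℝ}
    (hf : f ∈ SpecFuns m k d) {Ω : Set (Fin d → ℝ)} (hΩ : IsCompact Ω) {L : ℝ} (hL : 0 ≤ L)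
    {g : (Fin d → ℝ) → ℝ}
    (hg : ∀ x ∈ Ω, ∀ y ∈ Ω, |g x - g y| ≤ L * √(∑ i, (x i - y i) ^ 2)) :
    ∃ C, ∀ x ∈ Ω, |f x - g x| ≤ C := by
  rcases Ω.eq_empty_or_nonempty with rfl | ⟨x₀, hx₀⟩
  · exact ⟨0, fun x hx => absurd hx (Set.notMem_empty x)⟩
  obtain ⟨C, hC⟩ := bounded_of_mem_specFuns hm hf hΩ
  obtain ⟨R, hR⟩ := exists_sqrt_sum_sq_le hΩ x₀
  refine ⟨C + (L * R + |g x₀|), fun x hx => (abs_sub _ _).trans (add_le_add (hC x hx) ?_)⟩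
  have h1 := (hg x hx x₀ hx₀).trans (mul_le_mul_of_nonneg_left (hR x hx) hL)
  have h2 := abs_sub_abs_le_abs_sub (g x) (g x₀)
  linarith

lemma eventually_rpow_neg_lt {a b c C : ℝ} (hc : 0 < c) (hab : a < b) :
    ∀ᶠ m : ℕ in Filter.atTop, C * (m : ℝ) ^ (-b) < c * (m : ℝ) ^ (-a) := by
  have h1 : Filter.Tendsto (fun m : ℕ => (m : ℝ) ^ (b - a)) Filter.atTop Filter.atTop :=
    (tendsto_rpow_atTop (sub_pos.mpr hab)).comp tendsto_natCast_atTop_atTop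
  filter_upwards [h1.eventually_gt_atTop (C / c), Filter.eventually_ge_atTop 1] with m hm hm1
  have hm0 : (0 : ℝ) < m := by exact_mod_cast hm1
  have h2 : (m : ℝ) ^ (-a) = (m : ℝ) ^ (b - a) * (m : ℝ) ^ (-b) := by
    rw [← Real.rpow_add hm0]; congr 1; ring
  rw [h2, ← mul_assoc]
  rw [div_lt_iff₀' hc] at hm
  have h3 : 0 < (m : ℝ) ^ (-b) := by positivity
  gcongr

end SpectrahedralApproximation

/-- Lower bound on the rate of approximation of Lipschitz convex functions by
`(m,k_m)`-spectrahedral functions when `k_m ≤ c mᵗ`. -/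
theorem spectrahedral_approximation_lower_bound
    (d : ℕ) (hd : 1 ≤ d) (L : ℝ) (hL : 0 < L)
    (Ω : Set (Fin d → ℝ)) (hΩc : IsCompact Ω) (hΩconv : Convex ℝ Ω)
    (hΩfull : (interior Ω).Nonempty)
    (t c : ℝ) (ht0 : 0 ≤ t) (ht1 : t ≤ 1) (hc : 0 < c)
    (km : ℕ → ℝ) (hkm : ∃ M : ℕ, ∀ m : ℕ, M ≤ m → km m ≤ c * (m : ℝ) ^ t) :
    (∀ c1 : ℝ, 0 < c1 → ∀ r : ℝ, (4 / (d : ℝ)) * (1 + t) < r →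
      ∃ m : ℕ, 1 ≤ m ∧ ∃ fstar : (Fin d → ℝ) → ℝ,
        ConvexOn ℝ Ω fstar ∧
        (∀ x ∈ Ω, ∀ y ∈ Ω,
          |fstar x - fstar y| ≤ L * Real.sqrt (∑ i, (x i - y i) ^ 2)) ∧
        c1 * (m : ℝ) ^ (-r) <
          ⨅ f : SpecFuns m (km m) d,
            sSup {s : ℝ | ∃ x ∈ Ω, s = (f.1 x - fstar x) ^ 2}) ∧
    (∃ c2 : ℝ, 0 < c2 ∧ ∀ ε : ℝ, 0 < ε → ∃ M : ℕ, ∀ m : ℕ, M ≤ m →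
      c2 * (m : ℝ) ^ (-2 * (1 + t) / (d : ℝ) - ε) ≤
        sSup {s : ℝ | ∃ fstar : (Fin d → ℝ) → ℝ,
          ConvexOn ℝ Ω fstar ∧
          (∀ x ∈ Ω, ∀ y ∈ Ω,
            |fstar x - fstar y| ≤ L * Real.sqrt (∑ i, (x i - y i) ^ 2)) ∧
          s = ⨅ f : SpecFuns m (km m) d,
                sSup {a : ℝ | ∃ x ∈ Ω, a = |f.1 x - fstar x|}}) := by
  have hd0 : (0 : ℝ) < d := by exact_mod_cast hd
  constructor
  · intro c1 hc1 r hr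
    have hr' : 4 / (d : ℝ) < r := lt_of_le_of_lt (le_mul_of_one_le_right (by positivity)
      (by linarith)) hr
    obtain ⟨c₀, hc₀, hhard⟩ := exists_hard_function hd hL hΩconv hΩfull
      (ε := (r - 4 / d) / 4) (by linarith)
    obtain ⟨m, hlt, hm⟩ := ((eventually_rpow_neg_lt (C := c1) (pow_pos hc₀ 2)
      (show 4 / (d : ℝ) + (r - 4 / d) / 2 < r by linarith)).and
        (Filter.eventually_ge_atTop 1)).exists
    obtain ⟨g, hconv, hlip, hg⟩ := hhard m hm
    have : Nonempty (SpecFuns m (km m) d) := ⟨⟨_, const_mem_specFuns hm _ _ 0⟩⟩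
    refine ⟨m, hm, g, hconv, hlip, hlt.trans_le (le_ciInf fun f => ?_)⟩
    obtain ⟨x, hx, h⟩ := hg _ f.1 f.2
    obtain ⟨C, hC⟩ := exists_abs_sub_le hm f.2 hΩc hL.le hlip
    have hm0 : (0 : ℝ) < m := by exact_mod_cast hm
    calc c₀ ^ 2 * (m : ℝ) ^ (-(4 / (d : ℝ) + (r - 4 / d) / 2))
        = (c₀ * (m : ℝ) ^ (-(2 / d + (r - 4 / d) / 4))) ^ 2 := by
          rw [mul_pow, ← Real.rpow_natCast ((m : ℝ) ^ _) 2, ← Real.rpow_mul hm0.le]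
          congr 2
          push_cast
          ring
      _ ≤ |f.1 x - g x| ^ 2 := by gcongr
      _ = (f.1 x - g x) ^ 2 := sq_abs _
      _ ≤ _ := by
          refine le_csSup ⟨C ^ 2, ?_⟩ ⟨x, hx, rfl⟩
          rintro _ ⟨y, hy, rfl⟩
          rw [← sq_abs]
          have := hC y hy
          gcongr
  · refine ⟨1, one_pos, fun ε hε => ?_⟩
    obtain ⟨c₀, hc₀, hhard⟩ := exists_hard_function hd hL hΩconv hΩfull (half_pos hε)
    obtain ⟨M, hM⟩ := Filter.eventually_atTop.mp ((eventually_rpow_neg_lt (C := 1) hc₀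
      (show 2 / (d : ℝ) + ε / 2 < 2 / d + ε by linarith)).and
        (Filter.eventually_ge_atTop 1))
    refine ⟨M, fun m hMm => ?_⟩
    obtain ⟨hlt, hm⟩ := hM m hMm
    have hm1 : (1 : ℝ) ≤ m := by exact_mod_cast hm
    obtain ⟨g, hconv, hlip, hg⟩ := hhard m hm
    have : Nonempty (SpecFuns m (km m) d) := ⟨⟨_, const_mem_specFuns hm _ _ 0⟩⟩
    have hexp : -2 * (1 + t) / (d : ℝ) - ε ≤ -(2 / d + ε) := by
      have : 2 / (d : ℝ) ≤ 2 * (1 + t) / d := by gcongr; linarith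
      have h2 : -2 * (1 + t) / (d : ℝ) = -(2 * (1 + t) / d) := by ring
      linarith
    calc 1 * (m : ℝ) ^ (-2 * (1 + t) / (d : ℝ) - ε) ≤ 1 * (m : ℝ) ^ (-(2 / d + ε)) := by
          gcongr
      _ ≤ c₀ * (m : ℝ) ^ (-(2 / d + ε / 2)) := hlt.le
      _ ≤ ⨅ f : SpecFuns m (km m) d, sSup {a : ℝ | ∃ x ∈ Ω, a = |f.1 x - g x|} := by
          refine le_ciInf fun f => ?_
          obtain ⟨x, hx, h⟩ := hg _ f.1 f.2
          obtain ⟨C, hC⟩ := exists_abs_sub_le hm f.2 hΩc hL.le hlip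
          refine h.trans (le_csSup ⟨C, ?_⟩ ⟨x, hx, rfl⟩)
          rintro _ ⟨y, hy, rfl⟩
          exact hC y hy
      _ ≤ _ := by
          obtain ⟨x₀, hx₀⟩ := hΩfull.mono interior_subset
          obtain ⟨R, hR⟩ := exists_sqrt_sum_sq_le hΩc x₀
          refine le_csSup ⟨L * R, ?_⟩ ⟨g, hconv, hlip, rfl⟩
          rintro _ ⟨g', -, hlip', rfl⟩
          refine (ciInf_le ⟨0, ?_⟩ ⟨_, const_mem_specFuns hm _ _ (g' x₀)⟩).trans
            (csSup_le ⟨_, x₀, hx₀, rfl⟩ ?_)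
          · rintro _ ⟨f, rfl⟩
            refine Real.sSup_nonneg ?_
            rintro _ ⟨y, -, rfl⟩
            exact abs_nonneg _
          · rintro _ ⟨y, hy, rfl⟩
            rw [abs_sub_comm]
            exact (hlip' y hy x₀ hx₀).trans (mul_le_mul_of_nonneg_left (hR y hy) hL.le)
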